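/- arXiv:math/0403197 — 5 statements merged into one kernel-verified Lean document; each statement's English description precedes it below -/
import Mathlib

section
/- Let P be a finite nonempty set of prime numbers. The image of Z(P) under the diagonal embedding b ↦ (b, (b)_{p∈P}) into ℝ × ∏_{p∈P} ℚ_p is a discrete subset: every point of the image has a neighborhood (in the product topology) containing no other point of the image. -/
/-!
Formalization of statements from "Poisson boundary for finitely generated groups of
rational affinities" (S. Brofferio).

The finite nonempty set `P` of prime numbers is represented as the image of an
injective map `pr : ι → ℕ` (with `[∀ i, Fact (pr i).Prime]`) from a finite nonempty
index type `ι`.  The set `P̄ = P ∪ {∞}` is represented by `Option ι`, with `none`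
standing for `∞`.
-/

open MeasureTheory ProbabilityTheory Filter Topology
open scoped BigOperators

/-- `Z(P)`: the additive subgroup of `ℚ` of rationals of the form
`h * ∏_{p ∈ P} p^{h_p}` with `h, h_p ∈ ℤ`. -/
def ZP {ι : Type} [Fintype ι] (pr : ι → ℕ) : Set ℚ :=
  {q : ℚ | ∃ (h : ℤ) (k : ι → ℤ), q = (h : ℚ) * ∏ i, (pr i : ℚ) ^ (k i)}

/-- `(P)`: the multiplicative subgroup of `ℚ*` of numbers `± ∏_{p ∈ P} p^{k_p}`. -/
def MP {ι : Type} [Fintype ι] (pr : ι → ℕ) : Set ℚ :=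
  {a : ℚ | ∃ (s : ℚ) (k : ι → ℤ), (s = 1 ∨ s = -1) ∧ a = s * ∏ i, (pr i : ℚ) ^ (k i)}

/-- `Aff(P) = (P) ⋉ Z(P)`, as the set of pairs `(a, b)` in `ℚ × ℚ`. -/
def AffSet {ι : Type} [Fintype ι] (pr : ι → ℕ) : Set (ℚ × ℚ) :=
  {g : ℚ × ℚ | g.1 ∈ MP pr ∧ g.2 ∈ ZP pr}

/-- Multiplication in `Aff(P)`: `(a,b)(a',b') = (aa', ab' + b)`. -/
def affMul (g h : ℚ × ℚ) : ℚ × ℚ := (g.1 * h.1, g.1 * h.2 + g.2)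

/-- The `p`-adic absolute value `|q|_p` of a rational number, as a real number. -/
noncomputable def ratAbs (p : ℕ) (q : ℚ) : ℝ := ((padicNorm p q : ℚ) : ℝ)

/-- `ln⁺ t = max (ln t) 0`. -/
noncomputable def logPlus (t : ℝ) : ℝ := max (Real.log t) 0

/-- `μ` has a finite first (logarithmic) moment:
`∫ ∑_{p∈P} |ln |a|_p| dμ(a,b) < ∞` and `∫ ∑_{p∈P̄} ln⁺ |b|_p dμ(a,b) < ∞`. -/
def FirstMoment {ι : Type} [Fintype ι] (pr : ι → ℕ) (μ : Measure (ℚ × ℚ)) : Prop :=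
  Integrable (fun g : ℚ × ℚ => ∑ i, |Real.log (ratAbs (pr i) g.1)|) μ ∧
  Integrable (fun g : ℚ × ℚ =>
    (∑ i, logPlus (ratAbs (pr i) g.2)) + logPlus |(g.2 : ℝ)|) μ

/-- The `p`-drift `φ_p = ∫ ln |a|_p dμ(a,b)` for `p ∈ P`. -/
noncomputable def drift {ι : Type} (pr : ι → ℕ) (μ : Measure (ℚ × ℚ)) (i : ι) : ℝ :=
  ∫ g : ℚ × ℚ, Real.log (ratAbs (pr i) g.1) ∂μ

/-- The drift at `p = ∞`: `φ_∞ = ∫ ln |a|_∞ dμ(a,b)`. -/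
noncomputable def driftInf (μ : Measure (ℚ × ℚ)) : ℝ :=
  ∫ g : ℚ × ℚ, Real.log |(g.1 : ℝ)| ∂μ

/-- `A_n = a_1 ⋯ a_n`, where `X (k-1) = (a_k, b_k)` are the i.i.d. increments. -/
def RA {Ω : Type} (X : ℕ → Ω → ℚ × ℚ) (n : ℕ) (ω : Ω) : ℚ :=
  ∏ k ∈ Finset.range n, (X k ω).1

/-- `Z_n = ∑_{k=1}^n a_1 ⋯ a_{k-1} b_k` (the partial sums of the series `Z_∞`). -/
def RZ {Ω : Type} (X : ℕ → Ω → ℚ × ℚ) (n : ℕ) (ω : Ω) : ℚ :=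
  ∑ k ∈ Finset.range n, (∏ j ∈ Finset.range k, (X j ω).1) * (X k ω).2

theorem Padic.not_dvd_den_of_norm_ratCast_le_one {p : ℕ} [hp : Fact p.Prime] {q : ℚ}
    (hq : ‖(q : ℚ_[p])‖ ≤ 1) : ¬ p ∣ q.den := by
  intro hdvd
  have hden : ‖(q.den : ℚ_[p])‖ < 1 := Padic.norm_natCast_lt_one_iff.2 hdvd
  have hmul : (q.num : ℚ_[p]) = q * (q.den : ℚ_[p]) := by
    exact_mod_cast congrArg (Rat.cast : ℚ → ℚ_[p]) (Rat.mul_den_eq_num q).symm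
  have hnum : ‖(q.num : ℚ_[p])‖ < 1 := by
    rw [hmul, norm_mul]
    exact (mul_le_of_le_one_left (norm_nonneg _) hq).trans_lt hden
  have hdvd_num : p ∣ q.num.natAbs :=
    Int.natCast_dvd.1 ((Padic.norm_intCast_lt_one_iff (k := q.num)).1 hnum)
  exact hp.out.not_dvd_one (q.reduced ▸ Nat.dvd_gcd hdvd_num hdvd)

theorem Rat.den_eq_one_of_forall_padic_norm_le_one {q : ℚ}
    (hq : ∀ (p : ℕ) [Fact p.Prime], ‖(q : ℚ_[p])‖ ≤ 1) : q.den = 1 := by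
  by_contra hne
  obtain ⟨p, hp, hdvd⟩ := Nat.exists_prime_and_dvd hne
  have : Fact p.Prime := ⟨hp⟩
  exact Padic.not_dvd_den_of_norm_ratCast_le_one (hq p) hdvd

theorem Rat.eq_zero_of_abs_lt_one_of_forall_padic_norm_le_one {q : ℚ} (habs : |q| < 1)
    (hq : ∀ (p : ℕ) [Fact p.Prime], ‖(q : ℚ_[p])‖ ≤ 1) : q = 0 := by
  have hnum : (q.num : ℚ) = q :=
    Rat.coe_int_num_of_den_eq_one (Rat.den_eq_one_of_forall_padic_norm_le_one hq)
  rw [← hnum] at habs ⊢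
  exact_mod_cast Int.abs_lt_one_iff.1 (by exact_mod_cast habs)

theorem padic_norm_le_one_of_mem_ZP {ι : Type} [Fintype ι] {pr : ι → ℕ}
    [∀ i, Fact (pr i).Prime] {p : ℕ} [hp : Fact p.Prime] (hne : ∀ i, p ≠ pr i)
    {q : ℚ} (hq : q ∈ ZP pr) : ‖(q : ℚ_[p])‖ ≤ 1 := by
  obtain ⟨h, k, rfl⟩ := hq
  have hone (i : ι) : ‖(pr i : ℚ_[p])‖ = 1 :=
    Padic.norm_natCast_eq_one_iff.2 ((Nat.coprime_primes hp.out Fact.out).2 (hne i))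
  push_cast
  simpa [norm_prod, norm_zpow, hone] using Padic.norm_int_le_one (p := p) h

/-- The image of `Z(P)` under the diagonal embedding
`b ↦ (b, (b)_{p∈P})` into `ℝ × ∏_{p∈P} ℚ_p` is a discrete subset: every point of
the image has an open neighborhood (in the product topology) containing no other
point of the image. -/
theorem ZP_diagonal_embedding_discrete
    (ι : Type) [Fintype ι] [Nonempty ι] (pr : ι → ℕ) [∀ i, Fact (pr i).Prime]
    (hinj : Function.Injective pr) :
    ∀ b ∈ ZP pr, ∃ U : Set (ℝ × ((i : ι) → ℚ_[pr i])),
      IsOpen U ∧ ((b : ℝ), fun i => (b : ℚ_[pr i])) ∈ U ∧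
      ∀ b' ∈ ZP pr, ((b' : ℝ), fun i => (b' : ℚ_[pr i])) ∈ U → b' = b := by
  intro b hb
  refine ⟨Metric.ball ((b : ℝ), fun i => (b : ℚ_[pr i])) 1, Metric.isOpen_ball,
    Metric.mem_ball_self one_pos, fun b' hb' hmem => ?_⟩
  rw [Metric.mem_ball, Prod.dist_eq, max_lt_iff, dist_pi_lt_iff one_pos] at hmem
  obtain ⟨hreal, hpadic⟩ := hmem
  replace hreal : |(b' : ℝ) - b| < 1 := hreal
  refine sub_eq_zero.1 (Rat.eq_zero_of_abs_lt_one_of_forall_padic_norm_le_one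
    (by exact_mod_cast hreal) fun p _ => ?_)
  by_cases hp : ∃ i, p = pr i
  · obtain ⟨i, rfl⟩ := hp
    simpa [dist_eq_norm] using (hpadic i).le
  · push Not at hp
    rw [Rat.cast_sub, sub_eq_add_neg]
    refine (Padic.nonarchimedean _ _).trans (max_le (padic_norm_le_one_of_mem_ZP hp hb') ?_)
    rw [norm_neg]
    exact padic_norm_le_one_of_mem_ZP hp hb
end

section
/- Let P be a finite nonempty set of prime numbers. For every z_∞ ∈ ℝ and every choice of z_p ∈ ℚ_p for each p ∈ P, the set { b ∈ Z(P) : |z_∞ − b|_∞ ≤ 1 and |z_p − b|_p ≤ 1 for all p ∈ P } has exactly 2 or exactly 3 elements. -/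
/-!
Formalization of statements from "Poisson boundary for finitely generated groups of
rational affinities" (S. Brofferio).

The finite nonempty set `P` of prime numbers is represented as the image of an
injective map `pr : ι → ℕ` (with `[∀ i, Fact (pr i).Prime]`) from a finite nonempty
index type `ι`.  The set `P̄ = P ∪ {∞}` is represented by `Option ι`, with `none`
standing for `∞`.
-/

open MeasureTheory ProbabilityTheory Filter Topology
open scoped BigOperators

/-- `Z(P)` consists of the rationals whose denominator has all its prime factors in `P`. -/
theorem mem_ZP_iff_forall_prime_dvd_den {ι : Type} [Fintype ι] (pr : ι → ℕ)
    [hp : ∀ i, Fact (pr i).Prime] (hinj : Function.Injective pr) (q : ℚ) :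
    q ∈ ZP pr ↔ ∀ p : ℕ, p.Prime → p ∣ q.den → ∃ i, pr i = p := by
  constructor
  · rintro ⟨h, k, rfl⟩ p hpp hdvd
    rcases hpp.dvd_mul.mp (hdvd.trans (Rat.mul_den_dvd _ _)) with h1 | h1
    · exact absurd (by simpa using h1) hpp.ne_one
    · by_contra hne
      revert h1
      refine Finset.prod_induction _ (fun r : ℚ => ¬ p ∣ r.den) ?_ ?_ ?_
      · intro a b ha hb hab
        exact (hpp.dvd_mul.mp (hab.trans (Rat.mul_den_dvd _ _))).elim ha hb
      · simpa using hpp.ne_one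
      · intro i _ hi
        have hpi : p ∣ pr i := by
          obtain ⟨n, hn | hn⟩ := (k i).eq_nat_or_neg
          · rw [hn, zpow_natCast, ← Nat.cast_pow, Rat.den_natCast] at hi
            exact hi.trans (one_dvd _)
          · rw [hn, zpow_neg, zpow_natCast, ← Nat.cast_pow,
              Rat.inv_natCast_den_of_pos (pow_pos (hp i).out.pos n)] at hi
            exact hpp.dvd_of_dvd_pow hi
        exact hne ⟨i, ((Nat.prime_dvd_prime_iff_eq hpp (hp i).out).mp hpi).symm⟩
  · intro h
    refine ⟨q.num, fun i => -(q.den.factorization (pr i) : ℤ), ?_⟩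
    have hden : ∏ i, pr i ^ q.den.factorization (pr i) = q.den := by
      conv_rhs => rw [← Nat.prod_factorization_pow_eq_self q.den_nz]
      rw [Finsupp.prod_of_support_subset _ (s := Finset.univ.image pr) _ _ (by simp),
        Finset.prod_image hinj.injOn]
      intro p hmem
      rw [Nat.support_factorization, Nat.mem_primeFactors] at hmem
      obtain ⟨i, rfl⟩ := h p hmem.1 hmem.2.1
      exact Finset.mem_image_of_mem _ (Finset.mem_univ i)
    simp only [zpow_neg, zpow_natCast, Finset.prod_inv_distrib]
    have hden' : ∏ i, (pr i : ℚ) ^ q.den.factorization (pr i) = q.den := by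
      exact_mod_cast hden
    rw [hden', ← div_eq_mul_inv, Rat.num_div_den]

theorem Padic.norm_sub_le_one_of_le_one {p : ℕ} [Fact p.Prime] {x y : ℚ_[p]}
    (hx : ‖x‖ ≤ 1) (hy : ‖y‖ ≤ 1) : ‖x - y‖ ≤ 1 := by
  rw [sub_eq_add_neg]
  exact (IsUltrametricDist.norm_add_le_max _ _).trans (max_le hx (by rwa [norm_neg]))

/-- Every `p`-adic number is within distance `1` of a rational whose denominator is a power
of `p`. -/
theorem Padic.exists_rat_norm_sub_le_one (p : ℕ) [hp : Fact p.Prime] (z : ℚ_[p]) :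
    ∃ c : ℚ, ‖z - (c : ℚ_[p])‖ ≤ 1 ∧ ∀ q : ℕ, q.Prime → q ∣ c.den → q = p := by
  have hp0 : (0 : ℝ) < p := by exact_mod_cast hp.out.pos
  obtain ⟨n, hn⟩ := pow_unbounded_of_one_lt ‖z‖
    (show (1 : ℝ) < p by exact_mod_cast hp.out.one_lt)
  have hnorm : ‖(p : ℚ_[p]) ^ n‖ = ((p : ℝ) ^ n)⁻¹ := by
    rw [norm_pow, Padic.norm_p, inv_pow]
  have hx : ‖z * (p : ℚ_[p]) ^ n‖ ≤ 1 := by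
    rw [norm_mul, hnorm, ← div_eq_mul_inv]
    exact (div_le_one (by positivity)).mpr hn.le
  let x : ℤ_[p] := ⟨z * (p : ℚ_[p]) ^ n, hx⟩
  have happr := (PadicInt.norm_le_pow_iff_mem_span_pow _ n).mpr (PadicInt.appr_spec n x)
  have hpn : (p : ℚ_[p]) ^ n ≠ 0 := pow_ne_zero _ (by exact_mod_cast hp.out.ne_zero)
  refine ⟨(x.appr n : ℚ) / ((p ^ n : ℕ) : ℚ), ?_, ?_⟩
  · have heq : z - (((x.appr n : ℚ) / ((p ^ n : ℕ) : ℚ) : ℚ) : ℚ_[p]) =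
        ((x - (x.appr n : ℤ_[p]) : ℤ_[p]) : ℚ_[p]) / (p : ℚ_[p]) ^ n := by
      push_cast
      rw [sub_div]
      simp only [x]
      rw [mul_div_cancel_right₀ _ hpn]
    rw [heq, norm_div, hnorm, div_inv_eq_mul]
    rw [PadicInt.norm_def, zpow_neg, zpow_natCast] at happr
    calc _ ≤ ((p : ℝ) ^ n)⁻¹ * (p : ℝ) ^ n := by gcongr
      _ = 1 := inv_mul_cancel₀ (by positivity)
  · intro q hq hdvd
    have h1 : ((x.appr n : ℚ) / ((p ^ n : ℕ) : ℚ)).den ∣ p ^ n := by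
      have := Rat.den_dvd (x.appr n) ((p ^ n : ℕ) : ℤ)
      rw [Rat.divInt_eq_div] at this
      rw [Int.cast_natCast, Int.cast_natCast] at this
      exact Int.natCast_dvd_natCast.mp this
    exact (Nat.prime_dvd_prime_iff_eq hq hp.out).mp (hq.dvd_of_dvd_pow (hdvd.trans h1))

/-- Strong approximation for `Z(P)`: a family of `p`-adic numbers indexed by `P` is simultaneously
within distance `1` of an element of `Z(P)`. -/
theorem exists_mem_ZP_forall_norm_sub_le_one {ι : Type} [Fintype ι] (pr : ι → ℕ)
    [hp : ∀ i, Fact (pr i).Prime] (hinj : Function.Injective pr) (z : (i : ι) → ℚ_[pr i]) :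
    ∃ b ∈ ZP pr, ∀ i, ‖z i - ((b : ℚ) : ℚ_[pr i])‖ ≤ 1 := by
  classical
  choose c hc hden using fun i => Padic.exists_rat_norm_sub_le_one (pr i) (z i)
  refine ⟨∑ i, c i, ?_, fun i => ?_⟩
  · rw [mem_ZP_iff_forall_prime_dvd_den pr hinj]
    refine Finset.sum_induction _
      (fun r : ℚ => ∀ p : ℕ, p.Prime → p ∣ r.den → ∃ i, pr i = p) ?_ ?_ ?_
    · intro a b ha hb p hpp hab
      exact (hpp.dvd_mul.mp (hab.trans (Rat.add_den_dvd _ _))).elim (ha p hpp) (hb p hpp)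
    · intro p hpp h1
      exact absurd (by simpa using h1) hpp.ne_one
    · exact fun i _ p hpp h1 => ⟨i, (hden i p hpp h1).symm⟩
  · have hsplit : z i - ((∑ j, c j : ℚ) : ℚ_[pr i]) =
        (z i - c i) - ∑ j ∈ Finset.univ.erase i, (c j : ℚ_[pr i]) := by
      rw [← Finset.add_sum_erase _ _ (Finset.mem_univ i)]
      push_cast
      ring
    rw [hsplit]
    refine Padic.norm_sub_le_one_of_le_one (hc i) ?_
    refine IsUltrametricDist.norm_sum_le_of_forall_le_of_nonneg zero_le_one fun j hj => ?_
    refine Padic.norm_rat_le_one fun hdvd => Finset.ne_of_mem_erase hj ?_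
    exact (hinj (hden j (pr i) (hp i).out hdvd)).symm

/-- An element of `Z(P)` that is a `p`-adic integer for every `p ∈ P` is an integer. -/
theorem exists_int_eq_of_mem_ZP {ι : Type} [Fintype ι] (pr : ι → ℕ)
    [hp : ∀ i, Fact (pr i).Prime] (hinj : Function.Injective pr) {q : ℚ} (hq : q ∈ ZP pr)
    (hnorm : ∀ i, ‖(q : ℚ_[pr i])‖ ≤ 1) : ∃ n : ℤ, (n : ℚ) = q := by
  rw [mem_ZP_iff_forall_prime_dvd_den pr hinj] at hq
  refine ⟨q.num, Rat.coe_int_num_of_den_eq_one ?_⟩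
  refine Nat.eq_one_iff_not_exists_prime_dvd.mpr fun p hpp hdvd => ?_
  obtain ⟨i, rfl⟩ := hq p hpp hdvd
  exact Rat.padicValuation_le_one_iff.mp
    ((Padic.norm_rat_le_one_iff_padicValuation_le_one (pr i)).mp (hnorm i)) hdvd

/-- A closed real interval of length `2` contains two or three integers. -/
theorem card_Icc_ceil_sub_one_floor_add_one (t : ℝ) :
    (Finset.Icc ⌈t - 1⌉ ⌊t + 1⌋).card = 2 ∨ (Finset.Icc ⌈t - 1⌉ ⌊t + 1⌋).card = 3 := by
  rw [Int.card_Icc, Int.ceil_sub_one, Int.floor_add_one]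
  have h1 := Int.ceil_le_floor_add_one t
  have h2 := Int.floor_le_ceil t
  omega

/-- For every `z_∞ ∈ ℝ` and every choice of `z_p ∈ ℚ_p` for `p ∈ P`,
the set `{ b ∈ Z(P) : |z_∞ − b|_∞ ≤ 1 and |z_p − b|_p ≤ 1 for all p ∈ P }` has
exactly 2 or exactly 3 elements. -/
theorem ZP_close_points_card_two_or_three
    (ι : Type) [Fintype ι] [Nonempty ι] (pr : ι → ℕ) [∀ i, Fact (pr i).Prime]
    (hinj : Function.Injective pr)
    (zinf : ℝ) (z : (i : ι) → ℚ_[pr i]) :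
    let S : Set ℚ := {b : ℚ | b ∈ ZP pr ∧ |zinf - (b : ℝ)| ≤ 1 ∧
      ∀ i, ‖z i - (b : ℚ_[pr i])‖ ≤ 1}
    S.Finite ∧ (S.ncard = 2 ∨ S.ncard = 3) := by
  intro S
  obtain ⟨b₀, hb₀, hb₀z⟩ := exists_mem_ZP_forall_norm_sub_le_one pr hinj z
  have hS : S = (fun n : ℤ => b₀ + n) '' (Finset.Icc ⌈zinf - b₀ - 1⌉ ⌊zinf - b₀ + 1⌋ : Set ℤ) := by
    ext b
    simp only [S, Set.mem_ofPred_eq, Set.mem_image, Finset.coe_Icc, Set.mem_Icc, Int.ceil_le,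
      Int.le_floor]
    constructor
    · rintro ⟨hb, hbinf, hbz⟩
      obtain ⟨n, hn⟩ := exists_int_eq_of_mem_ZP pr hinj (q := b - b₀) (by
        rw [mem_ZP_iff_forall_prime_dvd_den pr hinj] at hb hb₀ ⊢
        intro p hp hdvd
        exact (hp.dvd_mul.mp (hdvd.trans (Rat.sub_den_dvd _ _))).elim (hb p hp) (hb₀ p hp))
        (fun i => by
          have heq : ((b - b₀ : ℚ) : ℚ_[pr i]) = (z i - b₀) - (z i - b) := by
            push_cast
            ring
          rw [heq]
          exact Padic.norm_sub_le_one_of_le_one (hb₀z i) (hbz i))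
      have hn' : (n : ℝ) = b - b₀ := by exact_mod_cast congrArg (Rat.cast : ℚ → ℝ) hn
      rw [abs_le] at hbinf
      exact ⟨n, ⟨by linarith, by linarith⟩, by rw [hn]; ring⟩
    · rintro ⟨n, ⟨hn1, hn2⟩, rfl⟩
      refine ⟨?_, ?_, fun i => ?_⟩
      · rw [mem_ZP_iff_forall_prime_dvd_den pr hinj] at hb₀ ⊢
        intro p hp hdvd
        have h1 := hdvd.trans (Rat.add_den_dvd _ _)
        rw [Rat.den_intCast, mul_one] at h1
        exact hb₀ p hp h1
      · push_cast
        rw [abs_le]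
        constructor <;> linarith
      · have heq : z i - ((b₀ + n : ℚ) : ℚ_[pr i]) = (z i - b₀) - n := by
          push_cast
          ring
        rw [heq]
        exact Padic.norm_sub_le_one_of_le_one (hb₀z i) (Padic.norm_int_le_one n)
  have hinj' : Function.Injective (fun n : ℤ => b₀ + (n : ℚ)) := fun m n h => by simpa using h
  rw [hS]
  refine ⟨(Finset.finite_toSet _).image _, ?_⟩
  rw [Set.ncard_image_of_injective _ hinj', Set.ncard_coe_finset]
  exact card_Icc_ceil_sub_one_floor_add_one _
end

section
/- Let P be a finite nonempty set of prime numbers and let S be a nonempty proper subset of P̄ = P ∪ {∞}. Then the image of Z(P) under the diagonal embedding b ↦ (b)_{p∈S} is dense in the product ∏_{p∈S} ℚ_p (with ℚ_∞ = ℝ), endowed with the product topology. -/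
/-!
Formalization of statements from "Poisson boundary for finitely generated groups of
rational affinities" (S. Brofferio).

The finite nonempty set `P` of prime numbers is represented as the image of an
injective map `pr : ι → ℕ` (with `[∀ i, Fact (pr i).Prime]`) from a finite nonempty
index type `ι`.  The set `P̄ = P ∪ {∞}` is represented by `Option ι`, with `none`
standing for `∞`.
-/

open MeasureTheory ProbabilityTheory Filter Topology
open scoped BigOperators

/-- The completions of `ℚ` indexed by `P̄ = P ∪ {∞}` (`Option ι`): `none ↦ ℚ_∞ = ℝ`,
`some i ↦ ℚ_{pr i}`. -/
def Qsp {ι : Type} (pr : ι → ℕ) [∀ i, Fact (pr i).Prime] : Option ι → Type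
  | none => ℝ
  | some i => ℚ_[pr i]

noncomputable instance {ι : Type} (pr : ι → ℕ) [∀ i, Fact (pr i).Prime] (j : Option ι) :
    NormedField (Qsp pr j) :=
  match j with
  | none => inferInstanceAs (NormedField ℝ)
  | some i => inferInstanceAs (NormedField ℚ_[pr i])

noncomputable instance {ι : Type} (pr : ι → ℕ) [∀ i, Fact (pr i).Prime] (j : Option ι) :
    MeasurableSpace (Qsp pr j) := borel _

/-- The drift `φ_p` for `p ∈ P̄`: `driftO pr μ none = φ_∞`, `driftO pr μ (some i) = φ_{pr i}`. -/
noncomputable def driftO {ι : Type} (pr : ι → ℕ) (μ : Measure (ℚ × ℚ)) :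
    Option ι → ℝ
  | none => driftInf μ
  | some i => drift pr μ i

/-- `Z(P)` is closed under addition. -/
theorem ZP_add_mem {ι : Type} [Fintype ι] (pr : ι → ℕ) [∀ i, Fact (pr i).Prime]
    {a b : ℚ} (ha : a ∈ ZP pr) (hb : b ∈ ZP pr) : a + b ∈ ZP pr := by
  have key : ∀ (k l : ι → ℤ), (∀ i, l i ≤ k i) →
      ∃ n : ℤ, ∏ i, (pr i : ℚ) ^ (k i) = n * ∏ i, (pr i : ℚ) ^ (l i) := by
    intro k l hkl
    refine ⟨∏ i, (pr i : ℤ) ^ (k i - l i).toNat, ?_⟩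
    push_cast
    rw [← Finset.prod_mul_distrib]
    refine Finset.prod_congr rfl fun i _ => ?_
    have hp : (pr i : ℚ) ≠ 0 := Nat.cast_ne_zero.2 (Fact.out : (pr i).Prime).ne_zero
    rw [← zpow_natCast, Int.toNat_of_nonneg (sub_nonneg.2 (hkl i)), ← zpow_add₀ hp,
      sub_add_cancel]
  obtain ⟨h, k, rfl⟩ := ha
  obtain ⟨h', k', rfl⟩ := hb
  obtain ⟨n, hn⟩ := key k (k ⊓ k') fun i => inf_le_left
  obtain ⟨n', hn'⟩ := key k' (k ⊓ k') fun i => inf_le_right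
  refine ⟨h * n + h' * n', k ⊓ k', ?_⟩
  rw [hn, hn']
  push_cast
  ring

/-- `Z(P)` contains the quotients of integers by products of powers of primes in `P`. -/
theorem intCast_div_prod_pow_mem_ZP {ι : Type} [Fintype ι] (pr : ι → ℕ) (h : ℤ) (m : ι → ℕ) :
    (h : ℚ) / ∏ i, (pr i : ℚ) ^ m i ∈ ZP pr :=
  ⟨h, fun i => -(m i : ℤ), by simp [div_eq_mul_inv]⟩

/-- Powers of `p` are eventually small in `ℚ_[p]`. -/
theorem Padic.exists_norm_p_pow_lt (p : ℕ) [Fact p.Prime] {δ : ℝ} (hδ : 0 < δ) :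
    ∃ n : ℕ, ‖(p : ℚ_[p]) ^ n‖ < δ := by
  obtain ⟨n, hn⟩ := exists_pow_lt_of_lt_one hδ (Padic.norm_p_lt_one (p := p))
  exact ⟨n, by rwa [norm_pow]⟩

theorem Padic.norm_natCast_le_one (p : ℕ) [Fact p.Prime] (n : ℕ) : ‖(n : ℚ_[p])‖ ≤ 1 := by
  simpa using Padic.norm_int_le_one (p := p) n

/-- A product of powers of primes is at most as large as its `i`-th factor in `ℚ_[pr i]`. -/
theorem Padic.norm_prod_pow_le {ι : Type} (s : Finset ι) (pr : ι → ℕ)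
    [∀ i, Fact (pr i).Prime] (m : ι → ℕ) {i : ι} (hi : i ∈ s) :
    ‖((∏ j ∈ s, pr j ^ m j : ℕ) : ℚ_[pr i])‖ ≤ ‖(pr i : ℚ_[pr i]) ^ m i‖ := by
  classical
  rw [← Finset.mul_prod_erase s _ hi, Nat.cast_mul, norm_mul, Nat.cast_pow]
  exact mul_le_of_le_one_right (norm_nonneg _) (Padic.norm_natCast_le_one _ _)

/-- Simultaneous approximation of `p`-adic integers by a natural number. -/
theorem PadicInt.exists_natCast_forall_norm_sub_lt {ι : Type} [Fintype ι] (pr : ι → ℕ)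
    [∀ i, Fact (pr i).Prime] (hinj : Function.Injective pr)
    (x : (i : ι) → ℤ_[pr i]) {δ : ι → ℝ} (hδ : ∀ i, 0 < δ i) :
    ∃ n : ℕ, ∀ i, ‖x i - n‖ < δ i := by
  choose a ha using fun i => PadicInt.denseRange_natCast.exists_dist_lt (x i) (hδ i)
  choose M hM using fun i => Padic.exists_norm_p_pow_lt (pr i) (hδ i)
  have hcop : Set.Pairwise (↑(Finset.univ : Finset ι))
      (Function.onFun Nat.Coprime fun i => pr i ^ M i) := fun i _ j _ hij =>
    Nat.Coprime.pow _ _ ((Nat.coprime_primes Fact.out Fact.out).2 (hinj.ne hij))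
  obtain ⟨n, hn⟩ := Nat.chineseRemainderOfFinset a (fun i => pr i ^ M i) Finset.univ
    (fun i _ => pow_ne_zero _ (Fact.out : (pr i).Prime).ne_zero) hcop
  refine ⟨n, fun i => ?_⟩
  have hd : ((pr i ^ M i : ℕ) : ℤ) ∣ (a i : ℤ) - n := (hn i (Finset.mem_univ i)).dvd
  obtain ⟨c, hc⟩ := hd
  have hc' : (a i : ℤ_[pr i]) - n = (pr i : ℤ_[pr i]) ^ M i * c := by
    simpa using congrArg (Int.cast : ℤ → ℤ_[pr i]) hc
  have h2 : ‖(a i : ℤ_[pr i]) - n‖ < δ i := by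
    rw [hc', norm_mul]
    refine (mul_le_of_le_one_right (norm_nonneg _) (PadicInt.norm_le_one _)).trans_lt ?_
    have := hM i
    rw [norm_pow] at this ⊢
    simpa using this
  have h1 : ‖x i - a i‖ < δ i := by simpa [dist_eq_norm] using ha i
  rw [← sub_add_sub_cancel (x i) (a i : ℤ_[pr i])]
  exact (PadicInt.nonarchimedean _ _).trans_lt (max_lt h1 h2)

/-- Simultaneous approximation at all the finite places by an element of `Z(P)`. -/
theorem exists_mem_ZP_forall_padic_norm_sub_lt {ι : Type} [Fintype ι] (pr : ι → ℕ)
    [∀ i, Fact (pr i).Prime] (hinj : Function.Injective pr)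
    (x : (i : ι) → ℚ_[pr i]) {ε : ℝ} (hε : 0 < ε) :
    ∃ b ∈ ZP pr, ∀ i, ‖x i - (b : ℚ_[pr i])‖ < ε := by
  choose m hm using fun i =>
    Padic.exists_norm_p_pow_lt (pr i) (inv_pos.2 (by positivity : 0 < ‖x i‖ + 1))
  set N : ℕ := ∏ i, pr i ^ m i with hN
  have hN0 : N ≠ 0 :=
    Finset.prod_ne_zero_iff.2 fun i _ => pow_ne_zero _ (Fact.out : (pr i).Prime).ne_zero
  have hNi : ∀ i, (0 : ℝ) < ‖(N : ℚ_[pr i])‖ := fun i => norm_pos_iff.2 (Nat.cast_ne_zero.2 hN0)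
  have hint : ∀ i, ∃ z : ℤ_[pr i], (z : ℚ_[pr i]) = N * x i := fun i => by
    suffices h : ‖(N : ℚ_[pr i]) * x i‖ ≤ 1 from ⟨⟨_, h⟩, rfl⟩
    have h1 := (Padic.norm_prod_pow_le Finset.univ pr m (Finset.mem_univ i)).trans (hm i).le
    rw [norm_mul]
    calc _ ≤ (‖x i‖ + 1)⁻¹ * (‖x i‖ + 1) := by gcongr; linarith
      _ = 1 := inv_mul_cancel₀ (by positivity)
  choose z hz using hint
  obtain ⟨n, hn⟩ := PadicInt.exists_natCast_forall_norm_sub_lt pr hinj z (δ := fun i => ε * ‖(N : ℚ_[pr i])‖)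
    fun i => mul_pos hε (hNi i)
  refine ⟨(n : ℚ) / N, ?_, fun i => ?_⟩
  · simpa [hN] using intCast_div_prod_pow_mem_ZP pr n m
  · have h := hn i
    rw [PadicInt.norm_def, PadicInt.coe_sub, PadicInt.coe_natCast, hz] at h
    have hNc : (N : ℚ_[pr i]) ≠ 0 := Nat.cast_ne_zero.2 hN0
    refine lt_of_mul_lt_mul_right ?_ (hNi i).le
    rw [← norm_mul]
    rwa [Rat.cast_div, Rat.cast_natCast, Rat.cast_natCast, sub_mul, div_mul_cancel₀ _ hNc,
      mul_comm]

/-- Approximation of a real number by elements of `Z(P)` that are small at every finite place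
but one. -/
theorem exists_mem_ZP_abs_sub_lt_and_padic_norm_lt {ι : Type} [Fintype ι] (pr : ι → ℕ)
    [∀ i, Fact (pr i).Prime] (hinj : Function.Injective pr) (i₀ : ι)
    (y : ℝ) {ε : ℝ} (hε : 0 < ε) :
    ∃ r ∈ ZP pr, |y - (r : ℝ)| < ε ∧ ∀ i, i ≠ i₀ → ‖(r : ℚ_[pr i])‖ < ε := by
  classical
  choose M hM using fun i => Padic.exists_norm_p_pow_lt (pr i) hε
  set D : ℕ := ∏ i ∈ Finset.univ.erase i₀, pr i ^ M i with hD
  have hD0 : 0 < D := Finset.prod_pos fun i _ => pow_pos (Fact.out : (pr i).Prime).pos _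
  have hDR : (0 : ℝ) < D := Nat.cast_pos.2 hD0
  have hq : (1 : ℝ) < pr i₀ := by exact_mod_cast (Fact.out : (pr i₀).Prime).one_lt
  obtain ⟨k, hk⟩ := pow_unbounded_of_one_lt (D / ε) hq
  have hQ : (0 : ℝ) < (pr i₀ : ℝ) ^ k := by positivity
  have hDk : (D : ℝ) / (pr i₀ : ℝ) ^ k < ε := by
    rw [div_lt_iff₀ hε] at hk
    rw [div_lt_iff₀ hQ]
    linarith
  set c : ℝ := (D : ℝ) / (pr i₀ : ℝ) ^ k with hc
  have hc0 : 0 < c := by positivity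
  refine ⟨((⌊y / c⌋ * D : ℤ) : ℚ) / (pr i₀ : ℚ) ^ k, ?_, ?_, fun i hi => ?_⟩
  · have h := intCast_div_prod_pow_mem_ZP pr (⌊y / c⌋ * D) (Pi.single i₀ k)
    rwa [Finset.prod_eq_single i₀ (fun j _ hj => by simp [hj]) (by simp), Pi.single_eq_same] at h
  · have h1 : ((((⌊y / c⌋ * D : ℤ) : ℚ) / (pr i₀ : ℚ) ^ k : ℚ) : ℝ) = ⌊y / c⌋ * c := by
      rw [hc]
      push_cast
      ring
    have h2 : y - ⌊y / c⌋ * c = Int.fract (y / c) * c := by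
      rw [Int.fract, sub_mul, div_mul_cancel₀ _ hc0.ne']
    rw [h1, h2, abs_of_nonneg (mul_nonneg (Int.fract_nonneg _) hc0.le)]
    exact (mul_le_of_le_one_left hc0.le (Int.fract_lt_one _).le).trans_lt hDk
  · have h1 : ‖(pr i₀ : ℚ_[pr i])‖ = 1 := by
      rw [Padic.norm_natCast_eq_one_iff]
      exact (Nat.coprime_primes Fact.out Fact.out).2 (hinj.ne hi)
    push_cast
    rw [norm_div, norm_pow, h1, one_pow, div_one, norm_mul]
    refine (mul_le_of_le_one_left (norm_nonneg _) (Padic.norm_int_le_one _)).trans_lt ?_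
    exact (Padic.norm_prod_pow_le _ pr M (by simpa using hi)).trans_lt (hM i)

/-- Let `S` be a nonempty proper subset of `P̄ = P ∪ {∞}`
(represented as `S : Set (Option ι)`, `none` standing for `∞`).  Then the image of
`Z(P)` under the diagonal embedding `b ↦ (b)_{p∈S}` is dense in `∏_{p∈S} ℚ_p`
(with `ℚ_∞ = ℝ`), endowed with the product topology. -/
theorem ZP_dense_in_proper_product
    (ι : Type) [Fintype ι] [Nonempty ι] (pr : ι → ℕ) [∀ i, Fact (pr i).Prime]
    (hinj : Function.Injective pr)
    (S : Set (Option ι)) (hne : S.Nonempty) (hproper : S ≠ Set.univ) :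
    Dense {x : (j : S) → Qsp pr j.1 |
      ∃ b ∈ ZP pr, x = fun j : S => ((b : ℚ) : Qsp pr j.1)} := by
  classical
  have : Fintype S := Fintype.ofFinite S
  rw [Metric.dense_iff]
  intro x ε hε
  obtain ⟨b, hb, hbi, hbn⟩ : ∃ b ∈ ZP pr,
      (∀ (i : ι) (hi : some i ∈ S),
        ‖(show ℚ_[pr i] from x ⟨some i, hi⟩) - (b : ℚ_[pr i])‖ < ε) ∧
      ∀ hn : none ∈ S, |(show ℝ from x ⟨none, hn⟩) - (b : ℝ)| < ε := by
    obtain ⟨b, hb, hbx⟩ := exists_mem_ZP_forall_padic_norm_sub_lt pr hinj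
      (fun i => if hi : some i ∈ S then (show ℚ_[pr i] from x ⟨some i, hi⟩) else 0) hε
    have hbS : ∀ (i : ι) (hi : some i ∈ S),
        ‖(show ℚ_[pr i] from x ⟨some i, hi⟩) - (b : ℚ_[pr i])‖ < ε := fun i hi => by
      have h := hbx i
      rwa [dif_pos hi] at h
    by_cases hn : none ∈ S
    · obtain ⟨i₀, hi₀⟩ : ∃ i, some i ∉ S := by
        by_contra! h
        exact hproper (Set.eq_univ_of_forall fun j => by cases j <;> simp [hn, h])
      obtain ⟨r, hr, hry, hri⟩ := exists_mem_ZP_abs_sub_lt_and_padic_norm_lt pr hinj i₀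
        ((show ℝ from x ⟨none, hn⟩) - b) hε
      refine ⟨b + r, ZP_add_mem pr hb hr, fun i hi => ?_, fun _ => ?_⟩
      · rw [Rat.cast_add, ← sub_sub, sub_eq_add_neg _ (r : ℚ_[pr i])]
        refine (Padic.nonarchimedean _ _).trans_lt (max_lt (hbS i hi) ?_)
        rw [norm_neg]
        exact hri i fun h => hi₀ (h ▸ hi)
      · rwa [Rat.cast_add, ← sub_sub]
    · exact ⟨b, hb, hbS, fun h => absurd h hn⟩
  refine ⟨fun j : S => ((b : ℚ) : Qsp pr j.1), ?_, b, hb, rfl⟩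
  rw [Metric.mem_ball, dist_comm, dist_pi_lt_iff hε]
  rintro ⟨_ | i, hj⟩
  · exact hbn hj
  · rw [dist_eq_norm]
    exact hbi i hj
end

section
/- Let μ be a probability measure on Aff(P) with finite first moment, let S = { p ∈ P̄ : φ_p < 0 }, and let B = ∏_{p∈S} ℚ_p with the coordinatewise action (a,b)·(x_p)_{p∈S} = (a x_p + b)_{p∈S} of Aff(P). Then there exists exactly one μ-invariant probability measure ν on B. -/
/-!
Formalization of statements from "Poisson boundary for finitely generated groups of
rational affinities" (S. Brofferio).

The finite nonempty set `P` of prime numbers is represented as the image of an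
injective map `pr : ι → ℕ` (with `[∀ i, Fact (pr i).Prime]`) from a finite nonempty
index type `ι`.  The set `P̄ = P ∪ {∞}` is represented by `Option ι`, with `none`
standing for `∞`.
-/

open MeasureTheory ProbabilityTheory Filter Topology
open scoped BigOperators

/-- The composition `T (ω 0) ∘ T (ω 1) ∘ ⋯ ∘ T (ω (n - 1))`, applied to `x`. -/
def backwardIterate {G E : Type*} (T : G → E → E) : ℕ → (ℕ → G) → E → E
  | 0, _, x => x
  | n + 1, ω, x => T (ω 0) (backwardIterate T n (fun k => ω (k + 1)) x)

/-- The sequence with first term `p.1` followed by the terms of `p.2`. -/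
def consSeq {G : Type*} (p : G × (ℕ → G)) : ℕ → G
  | 0 => p.1
  | n + 1 => p.2 n

theorem measurable_consSeq {G : Type*} [MeasurableSpace G] : Measurable (consSeq (G := G)) := by
  refine measurable_pi_iff.2 fun n => ?_
  cases n with
  | zero => exact measurable_fst
  | succ n => exact (measurable_pi_apply n).comp measurable_snd

theorem map_consSeq_infinitePi {G : Type*} [MeasurableSpace G] (μ : Measure G)
    [IsProbabilityMeasure μ] :
    (μ.prod (Measure.infinitePi fun _ : ℕ => μ)).map consSeq =
      Measure.infinitePi fun _ : ℕ => μ := by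
  classical
  refine Measure.eq_infinitePi _ fun s t ht => ?_
  obtain ⟨u, hu⟩ : ∃ u : ℕ → Set G, ∀ i, u i = if i ∈ s then t i else Set.univ :=
    ⟨_, fun _ => rfl⟩
  have hs : Set.pi (s : Set ℕ) t = Set.pi (Finset.range (s.sup id + 1) : Set ℕ) u := by
    ext x
    simp only [hu, Set.mem_pi, Finset.mem_coe, Finset.mem_range]
    refine ⟨fun h i _ => ?_, fun h i hi => ?_⟩
    · split_ifs with hi
      · exact h i hi
      · trivial
    · simpa [hi] using h i (Nat.lt_succ_of_le (Finset.le_sup (f := id) hi))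
  have hprod : ∏ i ∈ s, μ (t i) =
      ∏ i ∈ Finset.range (s.sup id + 1), μ (u i) := by
    have hsub : s ⊆ Finset.range (s.sup id + 1) := fun i hi =>
      Finset.mem_range.2 (Nat.lt_succ_of_le (Finset.le_sup (f := id) hi))
    rw [← Finset.prod_subset hsub]
    · exact Finset.prod_congr rfl fun i hi => by simp [hu, hi]
    · intro i _ hi
      simp [hu, hi]
  have ht' : ∀ i, MeasurableSet (u i) := fun i => by
    rw [hu]
    split_ifs
    · exact ht i
    · exact MeasurableSet.univ
  rw [hs, hprod, Measure.map_apply measurable_consSeq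
    (MeasurableSet.pi (Finset.countable_toSet _) fun i _ => ht' i)]
  have hpre : consSeq ⁻¹' Set.pi (Finset.range (s.sup id + 1) : Set ℕ) u =
      u 0 ×ˢ Set.pi (Finset.range (s.sup id) : Set ℕ) (fun i => u (i + 1)) := by
    ext p
    simp only [Set.mem_preimage, Set.mem_pi, Finset.mem_coe, Finset.mem_range, Set.mem_prod]
    refine ⟨fun h => ⟨h 0 (Nat.succ_pos _), fun i hi => h (i + 1) (Nat.succ_lt_succ hi)⟩, ?_⟩
    rintro ⟨h0, h1⟩ i hi
    cases i with
    | zero => exact h0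
    | succ i => exact h1 i (Nat.lt_of_succ_lt_succ hi)
  rw [hpre, Measure.prod_prod, Measure.infinitePi_pi _ fun i _ => ht' (i + 1),
    Finset.prod_range_succ', mul_comm]

section Letac

variable {G E : Type*} [MeasurableSpace G] [MeasurableSpace E]

theorem measurable_backwardIterate {T : G → E → E} (hT : Measurable fun p : G × E => T p.1 p.2)
    (n : ℕ) : Measurable fun p : (ℕ → G) × E => backwardIterate T n p.1 p.2 := by
  induction n with
  | zero => exact measurable_snd
  | succ n ih =>
    have h : Measurable fun p : (ℕ → G) × E => ((fun k => p.1 (k + 1)), p.2) := by fun_prop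
    exact hT.comp ((by fun_prop : Measurable fun p : (ℕ → G) × E => p.1 0).prodMk (ih.comp h))

theorem lintegral_backwardIterate_of_invariant {T : G → E → E}
    (hT : Measurable fun p : G × E => T p.1 p.2) (μ : Measure G) [IsProbabilityMeasure μ]
    (ν : Measure E) [IsProbabilityMeasure ν]
    (hν : (μ.prod ν).map (fun p => T p.1 p.2) = ν) (n : ℕ) :
    ∀ {F : E → ENNReal}, Measurable F →
      ∫⁻ ω, ∫⁻ x, F (backwardIterate T n ω x) ∂ν ∂(Measure.infinitePi fun _ : ℕ => μ) =
        ∫⁻ x, F x ∂ν := by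
  induction n with
  | zero => intro F _; simp [backwardIterate]
  | succ n ih =>
    intro F hF
    have hm : Measurable fun ω : ℕ → G => ∫⁻ x, F (backwardIterate T (n + 1) ω x) ∂ν :=
      (hF.comp (measurable_backwardIterate hT (n + 1))).lintegral_prod_right'
    rw [← map_consSeq_infinitePi, lintegral_map hm measurable_consSeq,
      lintegral_prod (fun p => ∫⁻ x, F (backwardIterate T (n + 1) (consSeq p) x) ∂ν)
        (hm.comp measurable_consSeq).aemeasurable]
    conv_rhs => rw [← hν, lintegral_map hF hT,
      lintegral_prod (fun p => F (T p.1 p.2)) (hF.comp hT).aemeasurable]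
    refine lintegral_congr fun g => ?_
    exact ih (hF.comp (hT.comp measurable_prodMk_left))

/-- **Letac's principle**: if the backward iterates of i.i.d. continuous random maps converge
almost surely to a limit which does not depend on the starting point, then there is exactly one
invariant probability measure. -/
theorem existsUnique_invariant_of_tendsto_backwardIterate [TopologicalSpace E]
    [TopologicalSpace.PseudoMetrizableSpace E] [T2Space E] [BorelSpace E] [HasOuterApproxClosed E]
    [Nonempty E]
    {T : G → E → E} (hT : Measurable fun p : G × E => T p.1 p.2) (hTc : ∀ g, Continuous (T g))
    (μ : Measure G) [IsProbabilityMeasure μ]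
    (hlim : ∀ᵐ ω ∂(Measure.infinitePi fun _ : ℕ => μ), ∃ z, ∀ x,
      Tendsto (fun n => backwardIterate T n ω x) atTop (𝓝 z)) :
    ∃! ν : Measure E, IsProbabilityMeasure ν ∧ (μ.prod ν).map (fun p => T p.1 p.2) = ν := by
  obtain ⟨x₀⟩ := ‹Nonempty E›
  set P := Measure.infinitePi fun _ : ℕ => μ with hP
  have hmeas : ∀ (n : ℕ) (x : E), Measurable fun ω => backwardIterate T n ω x := fun n x =>
    (measurable_backwardIterate hT n).comp measurable_prodMk_right
  obtain ⟨Z, hZ, hZlim⟩ := measurable_limit_of_tendsto_metrizable_ae (μ := P) (L := atTop)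
    (f := fun n ω => backwardIterate T n ω x₀) (fun n => (hmeas n x₀).aemeasurable)
    (hlim.mono fun ω ⟨z, hz⟩ => ⟨z, hz x₀⟩)
  have hall : ∀ᵐ ω ∂P, ∀ x, Tendsto (fun n => backwardIterate T n ω x) atTop (𝓝 (Z ω)) := by
    filter_upwards [hlim, hZlim] with ω ⟨z, hz⟩ h x
    rw [tendsto_nhds_unique h (hz x₀)]
    exact hz x
  refine ⟨P.map Z, ⟨Measure.isProbabilityMeasure_map hZ.aemeasurable, ?_⟩, ?_⟩
  · have hmap : μ.prod (P.map Z) = (μ.prod P).map (Prod.map id Z) := by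
      conv_lhs => rw [← Measure.map_id (μ := μ)]
      exact Measure.map_prod_map _ _ measurable_id hZ
    rw [hmap, Measure.map_map hT (measurable_id.prodMap hZ)]
    conv_rhs => rw [hP, ← map_consSeq_infinitePi, Measure.map_map hZ measurable_consSeq]
    refine Measure.map_congr ?_
    have h1 : ∀ᵐ p ∂(μ.prod P), Tendsto (fun n => backwardIterate T n (consSeq p) x₀) atTop
        (𝓝 (Z (consSeq p))) := by
      rw [hP, ← map_consSeq_infinitePi] at hZlim
      exact ae_of_ae_map measurable_consSeq.aemeasurable hZlim
    have h2 : ∀ᵐ p ∂(μ.prod P), Tendsto (fun n => backwardIterate T n p.2 x₀) atTop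
        (𝓝 (Z p.2)) := Measure.quasiMeasurePreserving_snd.ae hZlim
    filter_upwards [h1, h2] with p h1 h2
    exact tendsto_nhds_unique (((hTc p.1).tendsto _).comp h2)
      (h1.comp (tendsto_add_atTop_nat 1))
  · rintro ν ⟨hνp, hν⟩
    refine ext_of_forall_lintegral_eq_of_IsFiniteMeasure fun f => ?_
    have hf : Measurable fun x => (f x : ENNReal) := f.continuous.measurable.coe_nnreal_ennreal
    rw [lintegral_map hf hZ]
    have hconv : Tendsto (fun n => ∫⁻ p, (f (backwardIterate T n p.1 p.2) : ENNReal) ∂(P.prod ν))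
        atTop (𝓝 (∫⁻ p, (f (Z p.1) : ENNReal) ∂(P.prod ν))) := by
      refine tendsto_lintegral_of_dominated_convergence (fun _ => (nndist f 0 : ENNReal))
        (fun n => hf.comp (measurable_backwardIterate hT n)) (fun n => ?_) (by simp) ?_
      · exact Eventually.of_forall fun p =>
          ENNReal.coe_le_coe.2 (BoundedContinuousFunction.NNReal.upper_bound f _)
      · filter_upwards [Measure.quasiMeasurePreserving_fst.ae hall] with p hp
        exact (ENNReal.continuous_coe.comp f.continuous).continuousAt.tendsto.comp (hp p.2)
    refine tendsto_nhds_unique (f := fun _ : ℕ => ∫⁻ x, (f x : ENNReal) ∂ν) (l := atTop)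
      tendsto_const_nhds ?_
    have hZint : ∫⁻ p, (f (Z p.1) : ENNReal) ∂(P.prod ν) = ∫⁻ ω, f (Z ω) ∂P := by
      rw [lintegral_prod (fun p => (f (Z p.1) : ENNReal))
        (hf.comp (hZ.comp measurable_fst)).aemeasurable]
      simp
    rw [← hZint]
    refine hconv.congr fun n => ?_
    rw [lintegral_prod (fun p => (f (backwardIterate T n p.1 p.2) : ENNReal))
      (hf.comp (measurable_backwardIterate hT n)).aemeasurable]
    exact lintegral_backwardIterate_of_invariant hT μ ν hν n hf

end Letac

theorem tendsto_div_nat_of_tendsto_sum_div {u : ℕ → ℝ} {m : ℝ}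
    (h : Tendsto (fun n : ℕ => (∑ i ∈ Finset.range n, u i) / n) atTop (𝓝 m)) :
    Tendsto (fun n : ℕ => u n / n) atTop (𝓝 0) := by
  have h1 : Tendsto (fun n : ℕ => ((n + 1 : ℕ) : ℝ) / n) atTop (𝓝 1) := by
    have := tendsto_const_nhds (x := (1 : ℝ)).add (tendsto_one_div_atTop_nhds_zero_nat (𝕜 := ℝ))
    rw [add_zero] at this
    refine this.congr' ?_
    filter_upwards [eventually_gt_atTop 0] with n hn
    have : (n : ℝ) ≠ 0 := by positivity
    push_cast
    field_simp
  have h2 := (((tendsto_add_atTop_iff_nat 1).2 h).mul h1).sub h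
  rw [mul_one, sub_self] at h2
  refine h2.congr' ?_
  filter_upwards [eventually_gt_atTop 0] with n hn
  have : (n : ℝ) ≠ 0 := by positivity
  have h' : ((n + 1 : ℕ) : ℝ) ≠ 0 := by positivity
  rw [div_mul_div_cancel₀ h', Finset.sum_range_succ]
  ring

theorem norm_le_exp_logPlus {K : Type*} [NormedField K] (b : K) :
    ‖b‖ ≤ Real.exp (logPlus ‖b‖) := by
  rcases eq_or_ne b 0 with rfl | hb
  · simpa using (Real.exp_pos _).le
  · calc ‖b‖ = Real.exp (Real.log ‖b‖) := (Real.exp_log (norm_pos_iff.2 hb)).symm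
      _ ≤ _ := Real.exp_le_exp.2 (le_max_left _ _)

theorem norm_prod_eq_exp_sum_log {K : Type*} [NormedField K] {a : ℕ → K} (ha : ∀ n, a n ≠ 0)
    (n : ℕ) : ‖∏ k ∈ Finset.range n, a k‖ = Real.exp (∑ k ∈ Finset.range n, Real.log ‖a k‖) := by
  rw [norm_prod, Real.exp_sum]
  exact Finset.prod_congr rfl fun k _ => (Real.exp_log (norm_pos_iff.2 (ha k))).symm

/-- A series `∑ a₀ ⋯ aₖ₋₁ bₖ` converges when the logarithms of the `‖aₖ‖` have a negative mean and
the `log⁺ ‖bₖ‖` have a finite mean. -/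
theorem exists_tendsto_affine_backward {K : Type*} [NormedField K] [CompleteSpace K]
    {a b : ℕ → K} {φ m : ℝ} (hφ : φ < 0) (ha0 : ∀ n, a n ≠ 0)
    (ha : Tendsto (fun n : ℕ => (∑ i ∈ Finset.range n, Real.log ‖a i‖) / n) atTop (𝓝 φ))
    (hb : Tendsto (fun n : ℕ => (∑ i ∈ Finset.range n, logPlus ‖b i‖) / n) atTop (𝓝 m)) :
    ∃ z, ∀ x, Tendsto (fun n : ℕ => (∏ k ∈ Finset.range n, a k) * x +
      ∑ k ∈ Finset.range n, (∏ i ∈ Finset.range k, a i) * b k) atTop (𝓝 z) := by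
  have hA : ∀ᶠ n : ℕ in atTop, ‖∏ k ∈ Finset.range n, a k‖ ≤ Real.exp (n * (φ / 2)) := by
    filter_upwards [ha.eventually_lt_const (show φ < φ / 2 by linarith), eventually_gt_atTop 0]
      with n hn hn0
    rw [norm_prod_eq_exp_sum_log ha0, Real.exp_le_exp, mul_comm]
    exact ((div_lt_iff₀ (by positivity)).1 hn).le
  have hB : ∀ᶠ n : ℕ in atTop, ‖b n‖ ≤ Real.exp (n * (-φ / 4)) := by
    filter_upwards [(tendsto_div_nat_of_tendsto_sum_div hb).eventually_lt_const
      (show 0 < -φ / 4 by linarith), eventually_gt_atTop 0] with n hn hn0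
    refine (norm_le_exp_logPlus _).trans (Real.exp_le_exp.2 ?_)
    rw [mul_comm]
    exact ((div_lt_iff₀ (by positivity)).1 hn).le
  have hA0 : Tendsto (fun n : ℕ => ∏ k ∈ Finset.range n, a k) atTop (𝓝 0) := by
    refine squeeze_zero_norm' hA (Real.tendsto_exp_atBot.comp ?_)
    exact tendsto_natCast_atTop_atTop.atTop_mul_const_of_neg (by linarith)
  have hsum : Summable fun k => (∏ i ∈ Finset.range k, a i) * b k := by
    refine Summable.of_norm_bounded_eventually_nat (g := fun n : ℕ => Real.exp (n * (φ / 4)))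
      (Real.summable_exp_nat_mul_iff.2 (by linarith)) ?_
    filter_upwards [hA, hB] with n h1 h2
    rw [norm_mul]
    calc _ ≤ Real.exp (n * (φ / 2)) * Real.exp (n * (-φ / 4)) := by gcongr
      _ = _ := by rw [← Real.exp_add]; ring_nf
  refine ⟨∑' k, (∏ i ∈ Finset.range k, a i) * b k, fun x => ?_⟩
  have := (hA0.mul_const x).add hsum.hasSum.tendsto_sum_nat
  rwa [zero_mul, zero_add] at this

theorem backwardIterate_affine {G J : Type*} {K : J → Type*} [∀ j, NormedField (K j)]
    (a b : G → ∀ j, K j) (n : ℕ) (x : ∀ j, K j) (j : J) : ∀ ω : ℕ → G,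
    backwardIterate (fun g x j => a g j * x j + b g j) n ω x j =
      (∏ k ∈ Finset.range n, a (ω k) j) * x j +
        ∑ k ∈ Finset.range n, (∏ i ∈ Finset.range k, a (ω i) j) * b (ω k) j := by
  induction n with
  | zero => simp [backwardIterate]
  | succ n ih =>
    intro ω
    simp only [backwardIterate, ih, Finset.sum_range_succ' _ n, Finset.prod_range_succ' _,
      Finset.range_zero, Finset.prod_empty, one_mul, mul_add, Finset.mul_sum]
    rw [← add_assoc]
    congr 2
    · ring
    · exact Finset.sum_congr rfl fun k _ => by ring

theorem ae_tendsto_mean_infinitePi {G : Type*} [MeasurableSpace G] (μ : Measure G)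
    [IsProbabilityMeasure μ] {f : G → ℝ} (hfm : Measurable f) (hf : Integrable f μ) :
    ∀ᵐ ω ∂(Measure.infinitePi fun _ : ℕ => μ),
      Tendsto (fun n : ℕ => (∑ i ∈ Finset.range n, f (ω i)) / n) atTop (𝓝 (∫ g, f g ∂μ)) := by
  have hmp : ∀ i : ℕ, MeasurePreserving (Function.eval i) (Measure.infinitePi fun _ : ℕ => μ) μ :=
    fun i => measurePreserving_eval_infinitePi (fun _ : ℕ => μ) i
  have hind : iIndepFun (fun (i : ℕ) (ω : ℕ → G) => f (ω i)) (Measure.infinitePi fun _ : ℕ => μ) :=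
    iIndepFun_infinitePi (X := fun _ => f) (fun _ => hfm)
  have hint := (hmp 0).integrable_comp_of_integrable hf
  have h := strong_law_ae_real (fun (i : ℕ) (ω : ℕ → G) => f (ω i)) hint
    (fun i j hij => hind.indepFun hij) fun i =>
      ⟨(hfm.comp (measurable_pi_apply i)).aemeasurable,
        (hfm.comp (measurable_pi_apply 0)).aemeasurable, by
          have := fun i => Measure.map_map (μ := Measure.infinitePi fun _ : ℕ => μ) hfm
            (hmp i).measurable
          simp only [(hmp _).map_eq] at this
          exact (this i).symm.trans (this 0)⟩
  have h0 : ∫ ω, f (ω 0) ∂(Measure.infinitePi fun _ : ℕ => μ) = ∫ g, f g ∂μ := by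
    conv_rhs => rw [← (hmp 0).map_eq]
    exact (integral_map (hmp 0).measurable.aemeasurable hfm.aestronglyMeasurable).symm
  rwa [h0] at h

/-- Contraction on average at every place implies the existence and uniqueness of an invariant
probability measure for a random walk acting by affine maps on a finite product of complete
fields. -/
theorem existsUnique_invariant_affine {G J : Type*} [MeasurableSpace G]
    [DiscreteMeasurableSpace G] [Countable G] [Fintype J] {K : J → Type*}
    [∀ j, NormedField (K j)] [∀ j, CompleteSpace (K j)] [∀ j, SecondCountableTopology (K j)]
    [∀ j, MeasurableSpace (K j)] [∀ j, BorelSpace (K j)] (a b : G → ∀ j, K j)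
    (μ : Measure G) [IsProbabilityMeasure μ] (ha0 : ∀ᵐ g ∂μ, ∀ j, a g j ≠ 0)
    (ha : ∀ j, Integrable (fun g => Real.log ‖a g j‖) μ)
    (hφ : ∀ j, ∫ g, Real.log ‖a g j‖ ∂μ < 0)
    (hb : ∀ j, Integrable (fun g => logPlus ‖b g j‖) μ) :
    ∃! ν : Measure (∀ j, K j), IsProbabilityMeasure ν ∧
      (μ.prod ν).map (fun p => fun j => a p.1 j * p.2 j + b p.1 j) = ν := by
  have hc : ∀ g, Continuous fun (x : ∀ j, K j) j => a g j * x j + b g j := fun g => by fun_prop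
  refine existsUnique_invariant_of_tendsto_backwardIterate
    (T := fun g x j => a g j * x j + b g j)
    (measurable_from_prod_countable_right fun g => (hc g).measurable) hc μ ?_
  have h0 : ∀ᵐ ω ∂(Measure.infinitePi fun _ : ℕ => μ), ∀ n j, a (ω n) j ≠ 0 :=
    ae_all_iff.2 fun n =>
      (measurePreserving_eval_infinitePi (fun _ : ℕ => μ) n).quasiMeasurePreserving.ae ha0
  have h1 := ae_all_iff.2 fun j => ae_tendsto_mean_infinitePi μ .of_discrete (ha j)
  have h2 := ae_all_iff.2 fun j => ae_tendsto_mean_infinitePi μ .of_discrete (hb j)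
  filter_upwards [h0, h1, h2] with ω h0 h1 h2
  choose z hz using fun j =>
    exists_tendsto_affine_backward (hφ j) (fun n => h0 n j) (h1 j) (h2 j)
  refine ⟨z, fun x => tendsto_pi_nhds.2 fun j => ?_⟩
  simp only [backwardIterate_affine]
  exact hz j (x j)

section Completions

variable {ι : Type} (pr : ι → ℕ) [∀ i, Fact (pr i).Prime]

instance (j : Option ι) : CompleteSpace (Qsp pr j) :=
  match j with
  | none => inferInstanceAs (CompleteSpace ℝ)
  | some i => inferInstanceAs (CompleteSpace ℚ_[pr i])

instance (j : Option ι) : SecondCountableTopology (Qsp pr j) :=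
  match j with
  | none => inferInstanceAs (SecondCountableTopology ℝ)
  | some i => inferInstanceAs (SecondCountableTopology ℚ_[pr i])

instance (j : Option ι) : BorelSpace (Qsp pr j) := ⟨rfl⟩

theorem norm_ratCast_Qsp_none (q : ℚ) : ‖(q : Qsp pr none)‖ = |(q : ℝ)| := rfl

theorem norm_ratCast_Qsp_some (i : ι) (q : ℚ) : ‖(q : Qsp pr (some i))‖ = ratAbs (pr i) q :=
  Padic.eq_padicNorm q

theorem ratCast_Qsp_ne_zero (j : Option ι) {q : ℚ} (hq : q ≠ 0) : (q : Qsp pr j) ≠ 0 :=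
  match j with
  | none => (Rat.cast_ne_zero (α := ℝ)).2 hq
  | some i => (Rat.cast_ne_zero (α := ℚ_[pr i])).2 hq

theorem driftO_eq_integral (μ : Measure (ℚ × ℚ)) (j : Option ι) :
    driftO pr μ j = ∫ g, Real.log ‖(g.1 : Qsp pr j)‖ ∂μ :=
  match j with
  | none => rfl
  | some i => integral_congr_ae <| Eventually.of_forall fun g => by
      simp only [norm_ratCast_Qsp_some]

end Completions

section Moments

variable {ι : Type} [Fintype ι] {pr : ι → ℕ} [∀ i, Fact (pr i).Prime]

theorem ne_zero_of_mem_MP {q : ℚ} (hq : q ∈ MP pr) : q ≠ 0 := by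
  obtain ⟨s, k, hs, rfl⟩ := hq
  refine mul_ne_zero (by rcases hs with rfl | rfl <;> norm_num) (Finset.prod_ne_zero_iff.2 ?_)
  exact fun i _ => zpow_ne_zero _ (Nat.cast_ne_zero.2 (Fact.out : (pr i).Prime).ne_zero)

/-- The product formula for the units of `Z(P)`. -/
theorem log_abs_eq_neg_sum_of_mem_MP (hinj : Function.Injective pr) {q : ℚ} (hq : q ∈ MP pr) :
    Real.log |(q : ℝ)| = -∑ i, Real.log (ratAbs (pr i) q) := by
  obtain ⟨s, k, hs, rfl⟩ := hq
  have hpos : ∀ i, (0 : ℝ) < pr i := fun i =>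
    Nat.cast_pos.2 (Fact.out : (pr i).Prime).pos
  have hloc : ∀ i, ratAbs (pr i) (s * ∏ l, (pr l : ℚ) ^ k l) = (pr i : ℝ) ^ (-k i) := by
    intro i
    have hs' : padicNorm (pr i) s = 1 := by rcases hs with rfl | rfl <;> simp
    have hoff : ∀ l, l ≠ i → ‖((pr l : ℚ_[pr i]))‖ = 1 := fun l hl => by
      rw [Padic.norm_natCast_eq_one_iff]
      exact ((Nat.coprime_primes Fact.out Fact.out).2 (hinj.ne hl)).symm
    have h1 : ratAbs (pr i) (s * ∏ l, (pr l : ℚ) ^ k l) =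
        ‖((s * ∏ l, (pr l : ℚ) ^ k l : ℚ) : ℚ_[pr i])‖ := (Padic.eq_padicNorm _).symm
    have h2 : ‖(s : ℚ_[pr i])‖ = 1 := by
      rw [Padic.eq_padicNorm, hs', Rat.cast_one]
    rw [h1, Rat.cast_mul, norm_mul, h2, one_mul, Rat.cast_prod, norm_prod,
      Finset.prod_eq_single i]
    · simp
    · intro l _ hl
      simp [norm_zpow, hoff l hl]
    · simp
  have habs : |((s * ∏ l, (pr l : ℚ) ^ k l : ℚ) : ℝ)| = ∏ l, (pr l : ℝ) ^ k l := by
    have hp : 0 < ∏ l, (pr l : ℝ) ^ k l := Finset.prod_pos fun l _ => zpow_pos (hpos l) _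
    rcases hs with rfl | rfl <;> push_cast <;> simp [abs_of_pos hp]
  simp only [hloc]
  rw [habs, Real.log_prod fun i _ => (zpow_pos (hpos i) _).ne', ← Finset.sum_neg_distrib]
  simp [Real.log_zpow]

variable {μ : Measure (ℚ × ℚ)}

theorem integrable_log_norm_of_firstMoment (hinj : Function.Injective pr)
    (hAff : ∀ᵐ g ∂μ, g ∈ AffSet pr) (hmom : FirstMoment pr μ) (j : Option ι) :
    Integrable (fun g : ℚ × ℚ => Real.log ‖(g.1 : Qsp pr j)‖) μ := by
  refine hmom.1.mono' (Measurable.of_discrete).aestronglyMeasurable ?_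
  filter_upwards [hAff] with g hg
  cases j with
  | none =>
    rw [norm_ratCast_Qsp_none, log_abs_eq_neg_sum_of_mem_MP hinj hg.1, norm_neg]
    exact Finset.abs_sum_le_sum_abs _ _
  | some i =>
    rw [norm_ratCast_Qsp_some]
    exact Finset.single_le_sum (f := fun i => |Real.log (ratAbs (pr i) g.1)|)
      (fun _ _ => abs_nonneg _) (Finset.mem_univ i)

theorem integrable_logPlus_norm_of_firstMoment (hmom : FirstMoment pr μ) (j : Option ι) :
    Integrable (fun g : ℚ × ℚ => logPlus ‖(g.2 : Qsp pr j)‖) μ := by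
  refine hmom.2.mono' (Measurable.of_discrete).aestronglyMeasurable
    (Eventually.of_forall fun g => ?_)
  have hnn : ∀ t, 0 ≤ logPlus t := fun t => le_max_right _ _
  rw [Real.norm_of_nonneg (hnn _)]
  cases j with
  | none =>
    rw [norm_ratCast_Qsp_none]
    exact le_add_of_nonneg_left (Finset.sum_nonneg fun _ _ => hnn _)
  | some i =>
    rw [norm_ratCast_Qsp_some]
    exact (Finset.single_le_sum (f := fun i => logPlus (ratAbs (pr i) g.2))
      (fun _ _ => hnn _) (Finset.mem_univ i)).trans (le_add_of_nonneg_right (hnn _))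

end Moments

theorem map_prod_eq_iff_forall_lintegral {G E : Type*} [MeasurableSpace G] [MeasurableSpace E]
    {T : G → E → E} (hT : Measurable fun p : G × E => T p.1 p.2) (μ : Measure G) (ν : Measure E)
    [SFinite ν] :
    (μ.prod ν).map (fun p => T p.1 p.2) = ν ↔
      ∀ A : Set E, MeasurableSet A → ν A = ∫⁻ g, ν {x | T g x ∈ A} ∂μ := by
  have key : ∀ A : Set E, MeasurableSet A →
      (μ.prod ν).map (fun p => T p.1 p.2) A = ∫⁻ g, ν {x | T g x ∈ A} ∂μ := fun A hA => by
    rw [Measure.map_apply hT hA, Measure.prod_apply (hT hA)]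
    rfl
  refine ⟨fun h A hA => ?_, fun h => Measure.ext fun A hA => ?_⟩
  · rw [← key A hA, h]
  · rw [key A hA, h A hA]

/-- Let `μ` be a probability measure on `Aff(P)` with finite first
moment, `S = { p ∈ P̄ : φ_p < 0 }` and `B = ∏_{p∈S} ℚ_p`, with the coordinatewise
affine action of `Aff(P)`.  Then there exists exactly one `μ`-invariant probability
measure `ν` on `B`. -/
theorem unique_invariant_measure_on_boundary
    (ι : Type) [Fintype ι] [Nonempty ι] (pr : ι → ℕ) [∀ i, Fact (pr i).Prime]
    (hinj : Function.Injective pr)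
    (μ : Measure (ℚ × ℚ)) [IsProbabilityMeasure μ] (hAff : μ (AffSet pr) = 1)
    (hmom : FirstMoment pr μ) :
    ∃! ν : Measure ((j : {j : Option ι // driftO pr μ j < 0}) → Qsp pr j.1),
      IsProbabilityMeasure ν ∧
      ∀ E : Set ((j : {j : Option ι // driftO pr μ j < 0}) → Qsp pr j.1),
        MeasurableSet E →
        ν E = ∫⁻ g : ℚ × ℚ,
          ν {x | (fun j : {j : Option ι // driftO pr μ j < 0} =>
              (g.1 : Qsp pr j.1) * x j + (g.2 : Qsp pr j.1)) ∈ E} ∂μ := by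
  have hAe : ∀ᵐ g ∂μ, g ∈ AffSet pr := mem_ae_iff_prob_eq_one .of_discrete |>.2 hAff
  have h := existsUnique_invariant_affine (J := {j : Option ι // driftO pr μ j < 0})
    (K := fun j => Qsp pr j.1) (fun g j => (g.1 : Qsp pr j.1)) (fun g j => (g.2 : Qsp pr j.1)) μ
    (hAe.mono fun g hg j => ratCast_Qsp_ne_zero pr j.1 (ne_zero_of_mem_MP hg.1))
    (fun j => integrable_log_norm_of_firstMoment hinj hAe hmom j.1)
    (fun j => driftO_eq_integral pr μ j.1 ▸ j.2)
    (fun j => integrable_logPlus_norm_of_firstMoment hmom j.1)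
  refine (existsUnique_congr fun ν => and_congr_right fun hν => ?_).1 h
  have : IsProbabilityMeasure ν := hν
  exact map_prod_eq_iff_forall_lintegral (T := fun (g : ℚ × ℚ)
    (x : (j : {j : Option ι // driftO pr μ j < 0}) → Qsp pr j.1) j =>
      (g.1 : Qsp pr j.1) * x j + (g.2 : Qsp pr j.1))
    (measurable_from_prod_countable_right fun g => by fun_prop) μ ν
end

section
/- Let μ be a probability measure on Aff(P) with finite first moment such that the semigroup generated by the support of μ is all of Aff(P), and suppose φ_p = 0 for every p ∈ P̄. Then every bounded μ-harmonic function on Aff(P) is constant. -/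
/-!
Formalization of statements from "Poisson boundary for finitely generated groups of
rational affinities" (S. Brofferio).

The finite nonempty set `P` of prime numbers is represented as the image of an
injective map `pr : ι → ℕ` (with `[∀ i, Fact (pr i).Prime]`) from a finite nonempty
index type `ι`.  The set `P̄ = P ∪ {∞}` is represented by `Option ι`, with `none`
standing for `∞`.
-/

open MeasureTheory ProbabilityTheory Filter Topology
open scoped BigOperators

section Entropy

variable {α β γ : Type*} [MeasurableSpace α] [MeasurableSpace β] [MeasurableSpace γ]

/-- The Shannon entropy of a measure on a countable space, as an integral. -/
noncomputable def shannonEntropy (ν : Measure α) : ℝ := -∫ y, Real.log (ν.real {y}) ∂ν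

lemma ae_singleton_ne_zero [Countable α] (ν : Measure α) : ∀ᵐ y ∂ν, ν {y} ≠ 0 := by
  rw [ae_iff]
  refine (measure_null_iff_singleton (Set.to_countable _)).2 fun y hy => ?_
  simpa using hy

/-- Gibbs' inequality on a countable space: the entropy of `ν` is at most the cross entropy of `ν`
relative to a sub-probability mass function `q`. -/
lemma gibbs_inequality [Countable α] [MeasurableSingletonClass α] (ν : Measure α)
    [IsProbabilityMeasure ν] (q : α → ℝ) (hq : ∑' y, ENNReal.ofReal (q y) ≤ 1)
    (hpos : ∀ᵐ y ∂ν, 0 < q y) (hintegr : Integrable (fun y => Real.log (q y)) ν) :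
    Integrable (fun y => Real.log (ν.real {y})) ν ∧
      shannonEntropy ν ≤ -∫ y, Real.log (q y) ∂ν := by
  have hle : ∫⁻ y, ENNReal.ofReal (q y / ν.real {y}) ∂ν ≤ 1 := by
    rw [lintegral_countable']
    refine le_trans (ENNReal.tsum_le_tsum fun y => ?_) hq
    rcases eq_or_ne (ν {y}) 0 with h | h
    · simp [h]
    · have hp : 0 < ν.real {y} := ENNReal.toReal_pos h (measure_ne_top _ _)
      rw [ENNReal.ofReal_div_of_pos hp, Measure.real, ENNReal.ofReal_toReal (measure_ne_top _ _),
        ENNReal.div_mul_cancel h (measure_ne_top _ _)]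
  have hnn : 0 ≤ᵐ[ν] fun y => q y / ν.real {y} := by
    filter_upwards [hpos] with y hy using div_nonneg hy.le measureReal_nonneg
  have hmeas : AEStronglyMeasurable (fun y => q y / ν.real {y}) ν :=
    (Measurable.of_discrete).aestronglyMeasurable
  have hratio : Integrable (fun y => q y / ν.real {y}) ν := by
    refine ⟨hmeas, ?_⟩
    rw [hasFiniteIntegral_iff_ofReal hnn]
    exact hle.trans_lt ENNReal.one_lt_top
  have hratio_le : ∫ y, q y / ν.real {y} ∂ν ≤ 1 := by
    rw [integral_eq_lintegral_of_nonneg_ae hnn hmeas]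
    exact ENNReal.toReal_le_of_le_ofReal zero_le_one (by simpa using hle)
  have hbound : ∀ᵐ y ∂ν, -Real.log (ν.real {y}) ≤
      -Real.log (q y) + (q y / ν.real {y} - 1) := by
    filter_upwards [hpos, ae_singleton_ne_zero ν] with y hy hy'
    have hp : 0 < ν.real {y} := ENNReal.toReal_pos hy' (measure_ne_top _ _)
    have := Real.log_le_sub_one_of_pos (div_pos hy hp)
    rw [Real.log_div hy.ne' hp.ne'] at this
    linarith
  have hneg : Integrable (fun y => -Real.log (q y)) ν := hintegr.neg
  have hsub : Integrable (fun y => q y / ν.real {y} - 1) ν := hratio.sub (integrable_const 1)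
  have hintegr' : Integrable (fun y => -Real.log (q y) + (q y / ν.real {y} - 1)) ν := hneg.add hsub
  have hlog : Integrable (fun y => Real.log (ν.real {y})) ν := by
    refine hintegr'.mono' (Measurable.of_discrete).aestronglyMeasurable ?_
    filter_upwards [hbound] with y hy
    rwa [Real.norm_eq_abs, abs_of_nonpos (Real.log_nonpos measureReal_nonneg measureReal_le_one)]
  refine ⟨hlog, ?_⟩
  have := integral_mono_ae hlog.neg hintegr' hbound
  have h1 : ∫ y, (-Real.log (q y) + (q y / ν.real {y} - 1)) ∂ν =
      -∫ y, Real.log (q y) ∂ν + (∫ y, q y / ν.real {y} ∂ν - 1) := by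
    rw [integral_add hneg hsub, integral_neg, integral_sub hratio (integrable_const 1)]
    simp
  simp only [Pi.neg_apply, integral_neg] at this
  rw [h1] at this
  unfold shannonEntropy
  linarith

/-- The entropy increment dominates the average of any family of tilts that are sub-probabilities
relative to the image measure. -/
lemma shannonEntropy_add_integral_le [Countable α] [MeasurableSingletonClass α] [Countable β]
    [MeasurableSingletonClass β] [Countable γ] [MeasurableSingletonClass γ]
    (μ : Measure α) [IsProbabilityMeasure μ] (ν : Measure β) [IsProbabilityMeasure ν]
    (m : α → β → γ) (hm : ∀ᵐ x ∂μ, Function.Injective (m x)) (ρ : Measure γ)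
    [IsProbabilityMeasure ρ] (hρ : ρ = (μ.prod ν).map (fun z => m z.1 z.2))
    (hintegr : Integrable (fun g => Real.log (ρ.real {g})) ρ)
    (w : α → γ → ℝ) (C : ℝ) (hC : ∀ x g, |w x g| ≤ C)
    (hw : ∀ x, ∫⁻ g, ENNReal.ofReal (Real.exp (w x g)) ∂ρ ≤ 1) :
    shannonEntropy ν + ∫ x, ∫ y, w x (m x y) ∂ν ∂μ ≤ shannonEntropy ρ := by
  have hmm : Measurable (fun z : α × β => m z.1 z.2) := .of_discrete
  have hint2 : Integrable (fun z : α × β => Real.log (ρ.real {m z.1 z.2})) (μ.prod ν) := by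
    rw [hρ] at hintegr ⊢
    exact (integrable_map_measure (Measurable.of_discrete).aestronglyMeasurable
      hmm.aemeasurable).1 hintegr
  have hHρ : shannonEntropy ρ = -∫ x, ∫ y, Real.log (ρ.real {m x y}) ∂ν ∂μ := by
    rw [← integral_prod _ hint2, shannonEntropy]
    conv_lhs => rw [hρ]
    rw [integral_map hmm.aemeasurable (Measurable.of_discrete).aestronglyMeasurable, ← hρ]
  have hwint : ∀ x, Integrable (fun y => w x (m x y)) ν := fun x =>
    Integrable.of_bound (Measurable.of_discrete).aestronglyMeasurable C
      (Eventually.of_forall fun y => hC x _)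
  have hwint2 : Integrable (fun x => ∫ y, w x (m x y) ∂ν) μ := by
    refine Integrable.of_bound (Measurable.of_discrete).aestronglyMeasurable C
      (Eventually.of_forall fun x => ?_)
    refine (norm_integral_le_of_norm_le_const (C := C)
      (Eventually.of_forall fun y => hC x _)).trans (by simp)
  have hpt : ∀ᵐ x ∂μ, shannonEntropy ν ≤
      -∫ y, Real.log (ρ.real {m x y}) ∂ν - ∫ y, w x (m x y) ∂ν := by
    filter_upwards [hm, hint2.prod_right_ae, ae_singleton_ne_zero μ] with x hx hix hx0
    have hpos : ∀ᵐ y ∂ν, 0 < ρ.real {m x y} := by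
      filter_upwards [ae_singleton_ne_zero ν] with y hy
      refine ENNReal.toReal_pos (fun h0 => ?_) (measure_ne_top _ _)
      rw [hρ, Measure.map_apply hmm (measurableSet_singleton _)] at h0
      have : (μ.prod ν) ({x} ×ˢ {y}) = 0 := by
        refine measure_mono_null ?_ h0
        rintro ⟨a, b⟩ ⟨ha, hb⟩
        simp only [Set.mem_singleton_iff] at ha hb
        simp [ha, hb]
      rw [Measure.prod_prod] at this
      exact (mul_ne_zero hx0 hy) this
    have hlog : (fun y => Real.log (ρ.real {m x y} * Real.exp (w x (m x y)))) =ᵐ[ν]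
        fun y => Real.log (ρ.real {m x y}) + w x (m x y) := by
      filter_upwards [hpos] with y hy
      rw [Real.log_mul hy.ne' (Real.exp_pos _).ne', Real.log_exp]
    have hsum : ∑' y, ENNReal.ofReal (ρ.real {m x y} * Real.exp (w x (m x y))) ≤ 1 := by
      refine (ENNReal.tsum_comp_le_tsum_of_injective hx
        (fun g => ENNReal.ofReal (ρ.real {g} * Real.exp (w x g)))).trans ?_
      refine le_trans (le_of_eq ?_) (hw x)
      rw [lintegral_countable']
      refine tsum_congr fun g => ?_
      rw [ENNReal.ofReal_mul measureReal_nonneg, Measure.real,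
        ENNReal.ofReal_toReal (measure_ne_top _ _), mul_comm]
    have := (gibbs_inequality ν (fun y => ρ.real {m x y} * Real.exp (w x (m x y))) hsum
      (by filter_upwards [hpos] with y hy using mul_pos hy (Real.exp_pos _))
      ((integrable_congr hlog).2 (hix.add (hwint x)))).2
    rw [integral_congr_ae hlog, integral_add hix (hwint x)] at this
    linarith
  have hI := integral_mono_ae (integrable_const _)
    (hint2.integral_prod_left.neg.sub hwint2) hpt
  rw [integral_sub' hint2.integral_prod_left.neg hwint2] at hI
  simp only [integral_const, probReal_univ, one_smul, Pi.neg_apply, integral_neg] at hI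
  rw [hHρ]
  linarith

/-- If composing with an independent `μ`-distributed factor increases the entropy by at most `d`,
then conditioning on the value of this factor changes expectations of bounded functions little. -/
lemma mul_abs_integral_sub_le [Countable α] [MeasurableSingletonClass α] [Countable β]
    [MeasurableSingletonClass β] [Countable γ] [MeasurableSingletonClass γ]
    (μ : Measure α) [IsProbabilityMeasure μ] (ν : Measure β) [IsProbabilityMeasure ν]
    (m : α → β → γ) (hm : ∀ᵐ x ∂μ, Function.Injective (m x)) (ρ : Measure γ)
    [IsProbabilityMeasure ρ] (hρ : ρ = (μ.prod ν).map (fun z => m z.1 z.2))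
    (hintegr : Integrable (fun g => Real.log (ρ.real {g})) ρ)
    (F : γ → ℝ) (C : ℝ) (hF : ∀ g, |F g| ≤ C) (x₀ : α) (t : ℝ) (ht : |t| * (2 * C) ≤ 1) :
    μ.real {x₀} * (t * (∫ y, F (m x₀ y) ∂ν - ∫ g, F g ∂ρ) - t ^ 2 * (2 * C) ^ 2) ≤
      shannonEntropy ρ - shannonEntropy ν := by
  classical
  set u : ℝ := ∫ g, F g ∂ρ with hu
  have hFint : Integrable F ρ := Integrable.of_bound
    (Measurable.of_discrete).aestronglyMeasurable C (Eventually.of_forall hF)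
  have huC : |u| ≤ C := by
    simpa using norm_integral_le_of_norm_le_const (μ := ρ) (f := F) (Eventually.of_forall hF)
  have hdev : ∀ g, |t * (F g - u)| ≤ |t| * (2 * C) := fun g => by
    rw [abs_mul]
    refine mul_le_mul_of_nonneg_left ?_ (abs_nonneg _)
    have := abs_sub (F g) u
    linarith [hF g]
  set K : ℝ := t ^ 2 * (2 * C) ^ 2 with hK
  have hK0 : 0 ≤ K := by positivity
  have hsq : ∀ g, (t * (F g - u)) ^ 2 ≤ K := fun g => by
    have := pow_le_pow_left₀ (abs_nonneg _) (hdev g) 2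
    rwa [sq_abs, mul_pow |t|, sq_abs] at this
  have hexp : ∀ g, Real.exp (t * (F g - u)) ≤ 1 + t * (F g - u) + K := fun g => by
    have h1 := Real.abs_exp_sub_one_sub_id_le ((hdev g).trans ht)
    have h2 := le_abs_self (Real.exp (t * (F g - u)) - 1 - t * (F g - u))
    linarith [hsq g]
  have hInt1 : ∫⁻ g, ENNReal.ofReal (Real.exp (t * (F g - u) - K)) ∂ρ ≤ 1 := by
    have hle : ∀ g, Real.exp (t * (F g - u) - K) ≤ Real.exp (-K) * (1 + t * (F g - u) + K) := by
      intro g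
      rw [sub_eq_add_neg, Real.exp_add, mul_comm]
      exact mul_le_mul_of_nonneg_left (hexp g) (Real.exp_pos _).le
    have hi1 : Integrable (fun g => t * (F g - u)) ρ :=
      (hFint.sub (integrable_const u)).const_mul t
    have hi2 : Integrable (fun g => 1 + t * (F g - u)) ρ := (integrable_const 1).add hi1
    have hi : Integrable (fun g => Real.exp (-K) * (1 + t * (F g - u) + K)) ρ :=
      (hi2.add (integrable_const K)).const_mul _
    refine (lintegral_mono fun g => ENNReal.ofReal_le_ofReal (hle g)).trans ?_
    rw [← ofReal_integral_eq_lintegral_ofReal hi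
      (Eventually.of_forall fun g => (Real.exp_pos _).le.trans (hle g))]
    rw [ENNReal.ofReal_le_one, integral_const_mul,
      integral_add hi2 (integrable_const K), integral_add (integrable_const 1) hi1,
      integral_const_mul, integral_sub hFint (integrable_const u)]
    simp only [integral_const, probReal_univ, one_smul, ← hu, sub_self, mul_zero, add_zero]
    have := Real.add_one_le_exp K
    rw [Real.exp_neg, inv_mul_le_one₀ (Real.exp_pos _)]
    linarith
  have key := shannonEntropy_add_integral_le μ ν m hm ρ hρ hintegr
    (fun x g => if x = x₀ then t * (F g - u) - K else 0) (|t| * (2 * C) + K)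
    (fun x g => by
      split_ifs
      · refine (abs_sub _ _).trans ?_
        rw [abs_of_nonneg hK0]
        linarith [hdev g]
      · have := (abs_nonneg _).trans (hdev g)
        rw [abs_zero]
        linarith)
    (fun x => by
      split_ifs
      · exact hInt1
      · simp)
  have hval : ∫ x, ∫ y, (if x = x₀ then t * (F (m x y) - u) - K else 0) ∂ν ∂μ =
      μ.real {x₀} * (t * (∫ y, F (m x₀ y) ∂ν - u) - K) := by
    have : (fun x => ∫ y, (if x = x₀ then t * (F (m x y) - u) - K else 0) ∂ν) =
        Set.indicator {x₀} (fun _ => t * (∫ y, F (m x₀ y) ∂ν - u) - K) := by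
      funext x
      by_cases hx : x = x₀
      · have hi : Integrable (fun y => F (m x₀ y)) ν := Integrable.of_bound
          (Measurable.of_discrete).aestronglyMeasurable C (Eventually.of_forall fun y => hF _)
        have hi1 : Integrable (fun y => t * (F (m x₀ y) - u)) ν :=
          (hi.sub (integrable_const u)).const_mul t
        subst hx
        simp only [if_true, Set.mem_singleton_iff, Set.indicator_of_mem]
        rw [integral_sub hi1 (integrable_const K),
          integral_const_mul, integral_sub hi (integrable_const u)]
        simp
      · simp [hx]
    rw [this, integral_indicator_const _ (measurableSet_singleton _), smul_eq_mul]
  rw [hval] at key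
  linarith

end Entropy

section ConvolutionPowers

/-- The convolution powers of a measure for the multiplication `affMul`. -/
noncomputable def affPow (μ : Measure (ℚ × ℚ)) : ℕ → Measure (ℚ × ℚ)
  | 0 => Measure.dirac (1, 0)
  | n + 1 => (μ.prod (affPow μ n)).map (fun z => affMul z.1 z.2)

instance isProbabilityMeasure_affPow (μ : Measure (ℚ × ℚ)) [IsProbabilityMeasure μ] (n : ℕ) :
    IsProbabilityMeasure (affPow μ n) := by
  induction n with
  | zero => unfold affPow; infer_instance
  | succ n ih => exact Measure.isProbabilityMeasure_map (Measurable.of_discrete).aemeasurable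

lemma affMul_assoc (g h k : ℚ × ℚ) : affMul (affMul g h) k = affMul g (affMul h k) := by
  simp only [affMul, Prod.mk.injEq]
  constructor <;> ring

lemma affMul_one (g : ℚ × ℚ) : affMul g (1, 0) = g := by simp [affMul]

lemma one_affMul (g : ℚ × ℚ) : affMul (1, 0) g = g := by simp [affMul]

lemma affMul_injective {g : ℚ × ℚ} (hg : g.1 ≠ 0) : Function.Injective (affMul g) := by
  rintro ⟨a, b⟩ ⟨a', b'⟩ h
  simp only [affMul, Prod.mk.injEq, add_left_inj, mul_right_inj' hg] at h
  exact Prod.ext h.1 h.2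

lemma ae_mem_affPow {μ : Measure (ℚ × ℚ)} [IsProbabilityMeasure μ] {S : Set (ℚ × ℚ)}
    (hone : (1, 0) ∈ S) (hmul : ∀ g ∈ S, ∀ h ∈ S, affMul g h ∈ S) (hμ : ∀ᵐ g ∂μ, g ∈ S) (n : ℕ) :
    ∀ᵐ g ∂(affPow μ n), g ∈ S := by
  induction n with
  | zero => simpa [affPow] using hone
  | succ n ih =>
    rw [affPow, ae_map_iff (Measurable.of_discrete).aemeasurable (.of_discrete)]
    filter_upwards [Measure.quasiMeasurePreserving_fst.ae hμ,
      Measure.quasiMeasurePreserving_snd.ae ih] with z h1 h2 using hmul _ h1 _ h2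

lemma eq_integral_affPow {μ : Measure (ℚ × ℚ)} [IsProbabilityMeasure μ] {S : Set (ℚ × ℚ)}
    (hmul : ∀ g ∈ S, ∀ h ∈ S, affMul g h ∈ S) (hμ : ∀ᵐ g ∂μ, g ∈ S)
    {f : ℚ × ℚ → ℝ} {C : ℝ} (hf : ∀ g, |f g| ≤ C)
    (hharm : ∀ g ∈ S, f g = ∫ h, f (affMul g h) ∂μ) (n : ℕ) :
    ∀ g ∈ S, f g = ∫ h, f (affMul g h) ∂(affPow μ n) := by
  induction n with
  | zero => intro g _; simp [affPow, affMul_one]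
  | succ n ih =>
    intro g hg
    rw [affPow, integral_map (Measurable.of_discrete).aemeasurable
      (Measurable.of_discrete).aestronglyMeasurable, integral_prod, hharm g hg]
    · refine integral_congr_ae ?_
      filter_upwards [hμ] with h hh
      rw [ih _ (hmul g hg h hh)]
      simp_rw [affMul_assoc]
    · exact Integrable.of_bound (Measurable.of_discrete).aestronglyMeasurable C
        (Eventually.of_forall fun z => hf _)

/-- If the entropies of the convolution powers grow sublinearly, then bounded harmonic functions
are constant. -/
lemma eq_of_bounded_harmonic_of_entropy {μ : Measure (ℚ × ℚ)} [IsProbabilityMeasure μ]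
    {S : Set (ℚ × ℚ)} (hone : (1, 0) ∈ S) (hmul : ∀ g ∈ S, ∀ h ∈ S, affMul g h ∈ S)
    (hne : ∀ g ∈ S, g.1 ≠ 0) (hμ : ∀ᵐ g ∂μ, g ∈ S)
    (hgen : ∀ T : Set (ℚ × ℚ), {g : ℚ × ℚ | μ {g} ≠ 0} ⊆ T →
      (∀ g ∈ T, ∀ h ∈ T, affMul g h ∈ T) → S ⊆ T)
    (hintegr : ∀ n, Integrable (fun g => Real.log ((affPow μ n).real {g})) (affPow μ n))
    (hent : ∀ ε > 0, ∃ n : ℕ, 0 < n ∧ shannonEntropy (affPow μ n) ≤ ε * n)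
    {f : ℚ × ℚ → ℝ} {C : ℝ} (hf : ∀ g ∈ S, |f g| ≤ C)
    (hharm : ∀ g ∈ S, f g = ∫ h, f (affMul g h) ∂μ) :
    ∀ g ∈ S, ∀ g' ∈ S, f g = f g' := by
  classical
  set F : ℚ × ℚ → ℝ := S.indicator f with hFdef
  have hFS : ∀ g ∈ S, F g = f g := fun g hg => Set.indicator_of_mem hg f
  have hC0 : 0 ≤ C := (abs_nonneg _).trans (hf _ hone)
  have hFC : ∀ g, |F g| ≤ C := fun g => by
    by_cases hg : g ∈ S
    · rw [hFS g hg]; exact hf g hg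
    · simpa [hFdef, hg] using hC0
  have hFharm : ∀ g ∈ S, F g = ∫ h, F (affMul g h) ∂μ := fun g hg => by
    rw [hFS g hg, hharm g hg]
    refine integral_congr_ae ?_
    filter_upwards [hμ] with h hh using (hFS _ (hmul g hg h hh)).symm
  have hsmall : ∀ ε > 0, ∃ k, shannonEntropy (affPow μ (k + 1)) - shannonEntropy (affPow μ k)
      ≤ ε := by
    intro ε hε
    obtain ⟨n, hn, hle⟩ := hent ε hε
    by_contra! hcon
    have h0 : shannonEntropy (affPow μ 0) = 0 := by simp [shannonEntropy, affPow, Measure.real]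
    have hsum := Finset.sum_range_sub (fun k => shannonEntropy (affPow μ k)) n
    have hlt : ∑ k ∈ Finset.range n, ε < ∑ k ∈ Finset.range n,
        (shannonEntropy (affPow μ (k + 1)) - shannonEntropy (affPow μ k)) :=
      Finset.sum_lt_sum_of_nonempty ⟨0, by simpa using hn⟩ fun k _ => hcon k
    rw [hsum, h0] at hlt
    simp only [Finset.sum_const, Finset.card_range, nsmul_eq_mul] at hlt
    linarith [mul_comm (n : ℝ) ε]
  have hinv : ∀ x, μ {x} ≠ 0 → x ∈ S ∧ ∀ γ ∈ S, F (affMul γ x) = F γ := by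
    intro x hx
    have hxS : x ∈ S := by
      by_contra hxS
      exact hx (measure_mono_null (by simpa using hxS) (ae_iff.1 hμ))
    refine ⟨hxS, fun γ hγ => ?_⟩
    have hpx : 0 < μ.real {x} := ENNReal.toReal_pos hx (measure_ne_top _ _)
    set Δ := F (affMul γ x) - F γ with hΔ
    have hmain : ∀ t : ℝ, |t| * (2 * C) ≤ 1 → t * Δ ≤ t ^ 2 * (2 * C) ^ 2 := by
      intro t ht
      refine le_of_forall_pos_le_add fun ε hε => ?_
      obtain ⟨k, hk⟩ := hsmall (μ.real {x} * ε) (mul_pos hpx hε)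
      have key := mul_abs_integral_sub_le μ (affPow μ k) affMul
        (by filter_upwards [hμ] with g hg using affMul_injective (hne g hg))
        (affPow μ (k + 1)) rfl (hintegr _) (fun g => F (affMul γ g)) C (fun g => hFC _) x t ht
      simp_rw [← affMul_assoc] at key
      rw [← eq_integral_affPow hmul hμ hFC hFharm k _ (hmul γ hγ x hxS),
        ← eq_integral_affPow hmul hμ hFC hFharm (k + 1) _ hγ] at key
      have := le_of_mul_le_mul_left (key.trans hk) hpx
      linarith
    have hlim : ∀ s : ℝ, |s| = 1 → s * Δ ≤ 0 := by
      intro s hs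
      refine le_of_forall_pos_le_add fun ε hε => ?_
      set D := 2 * C + (2 * C) ^ 2 + 1 with hD
      have hD1 : 0 < D := by positivity
      set t := min (ε / D) (1 / D) with ht
      have ht0 : 0 < t := lt_min (div_pos hε hD1) (div_pos one_pos hD1)
      have ht1 : t * D ≤ 1 := by
        rw [← le_div_iff₀ hD1]; exact min_le_right _ _
      have ht2 : t * D ≤ ε := by
        rw [← le_div_iff₀ hD1]; exact min_le_left _ _
      have h2 := hmain (t * s) (by
        rw [abs_mul, hs, abs_of_pos ht0, mul_one]
        refine le_trans (mul_le_mul_of_nonneg_left ?_ ht0.le) ht1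
        nlinarith [sq_nonneg (2 * C)])
      have hs2 : s ^ 2 = 1 := by rw [← sq_abs, hs, one_pow]
      rw [mul_pow, hs2, mul_one, mul_assoc, pow_two t, mul_assoc] at h2
      have h3 := le_of_mul_le_mul_left h2 ht0
      have h4 : t * (2 * C) ^ 2 ≤ t * D := mul_le_mul_of_nonneg_left (by linarith) ht0.le
      linarith
    have h1 := hlim 1 (by simp)
    have h2 := hlim (-1) (by simp)
    linarith
  have hT := hgen {x | x ∈ S ∧ ∀ γ ∈ S, F (affMul γ x) = F γ} hinv (by
    rintro g ⟨hg, hg'⟩ h ⟨hh, hh'⟩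
    refine ⟨hmul g hg h hh, fun γ hγ => ?_⟩
    rw [← affMul_assoc, hh' _ (hmul γ hγ g hg), hg' γ hγ])
  have hconst : ∀ g ∈ S, f g = F (1, 0) := fun g hg => by
    rw [← hFS g hg, ← (hT hg).2 _ hone, one_affMul]
  intro g hg g' hg'
  rw [hconst g hg, hconst g' hg']

end ConvolutionPowers

section PathSpace

/-- The product `ω (n - 1) ⋯ ω 1 ω 0` of the first `n` increments of a path. -/
def affWalk (ω : ℕ → ℚ × ℚ) : ℕ → ℚ × ℚ
  | 0 => (1, 0)
  | n + 1 => affMul (ω n) (affWalk ω n)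

lemma measurable_affWalk (n : ℕ) : Measurable (fun ω => affWalk ω n) := by
  induction n with
  | zero => exact measurable_const
  | succ n ih =>
    exact (Measurable.of_discrete (f := fun z : (ℚ × ℚ) × (ℚ × ℚ) => affMul z.1 z.2)).comp
      ((measurable_pi_apply n).prodMk ih)

lemma affWalk_congr {ω ω' : ℕ → ℚ × ℚ} {n : ℕ} (h : ∀ i < n, ω i = ω' i) :
    affWalk ω n = affWalk ω' n := by
  induction n with
  | zero => rfl
  | succ n ih => rw [affWalk, affWalk, h n n.lt_succ_self, ih fun i hi => h i (by omega)]

variable (μ : Measure (ℚ × ℚ)) [IsProbabilityMeasure μ]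

lemma indepFun_affWalk (n : ℕ) :
    IndepFun (fun ω : ℕ → ℚ × ℚ => ω n) (fun ω => affWalk ω n)
      (Measure.infinitePi fun _ => μ) := by
  have hI : iIndepFun (fun (i : ℕ) (ω : ℕ → ℚ × ℚ) => ω i) (Measure.infinitePi fun _ => μ) :=
    iIndepFun_infinitePi (X := fun _ x => x) fun _ => measurable_id
  have h := hI.indepFun_finset {n} (Finset.range n) (by simp) fun i => measurable_pi_apply i
  let ext : (Finset.range n → ℚ × ℚ) → ℕ → ℚ × ℚ :=
    fun x i => if hi : i ∈ Finset.range n then x ⟨i, hi⟩ else (1, 0)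
  have hext : Measurable ext := by
    refine measurable_pi_lambda _ fun i => ?_
    by_cases hi : i ∈ Finset.range n
    · simpa only [ext, hi, dif_pos] using measurable_pi_apply _
    · simpa only [ext, hi, dif_neg, not_false_eq_true] using measurable_const
  have hproj : Measurable (fun x : ({n} : Finset ℕ) → ℚ × ℚ =>
      x ⟨n, Finset.mem_singleton_self n⟩) :=
    measurable_pi_apply _
  have h2 := h.comp (ψ := fun x => affWalk (ext x) n) hproj ((measurable_affWalk n).comp hext)
  have hwalk : (fun ω : ℕ → ℚ × ℚ => affWalk ω n) =
      (fun x => affWalk (ext x) n) ∘ fun ω (i : Finset.range n) => ω i := by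
    funext ω
    refine affWalk_congr fun i hi => ?_
    simp [ext, hi]
  rw [hwalk]
  exact h2

lemma map_affWalk (n : ℕ) :
    (Measure.infinitePi fun _ : ℕ => μ).map (fun ω => affWalk ω n) = affPow μ n := by
  induction n with
  | zero => simp [affWalk, affPow]
  | succ n ih =>
    have h := (indepFun_affWalk μ n).map_prod_eq_prod_map_map
      (measurable_pi_apply n).aemeasurable (measurable_affWalk n).aemeasurable
    rw [ih, Measure.infinitePi_map_eval] at h
    rw [affPow, ← h, Measure.map_map (.of_discrete)
      ((measurable_pi_apply n).prodMk (measurable_affWalk n))]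
    rfl

lemma integrable_eval {h : ℚ × ℚ → ℝ} (hh : Integrable h μ) (i : ℕ) :
    Integrable (fun ω : ℕ → ℚ × ℚ => h (ω i)) (Measure.infinitePi fun _ => μ) :=
  (measurePreserving_eval_infinitePi (fun _ : ℕ => μ) i).integrable_comp_of_integrable hh

lemma integral_eval (h : ℚ × ℚ → ℝ) (i : ℕ) :
    ∫ ω : ℕ → ℚ × ℚ, h (ω i) ∂(Measure.infinitePi fun _ => μ) = ∫ g, h g ∂μ := by
  conv_rhs => rw [← Measure.infinitePi_map_eval (fun _ : ℕ => μ) i]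
  rw [integral_map (measurable_pi_apply i).aemeasurable
    (Measurable.of_discrete).aestronglyMeasurable]

/-- The `L¹` law of large numbers for the increments of a path. -/
lemma eventually_integral_abs_sum_le {h : ℚ × ℚ → ℝ} (hh : Integrable h μ)
    (h0 : ∫ g, h g ∂μ = 0) {δ : ℝ} (hδ : 0 < δ) :
    ∀ᶠ n : ℕ in atTop, ∫ ω : ℕ → ℚ × ℚ, |∑ i ∈ Finset.range n, h (ω i)|
      ∂(Measure.infinitePi fun _ => μ) ≤ δ * n := by
  set P : Measure (ℕ → ℚ × ℚ) := Measure.infinitePi fun _ => μ with hP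
  have hmeas : ∀ i : ℕ, Measurable (fun ω : ℕ → ℚ × ℚ => h (ω i)) := fun i =>
    (Measurable.of_discrete (f := h)).comp (measurable_pi_apply i)
  have hI : iIndepFun (fun (i : ℕ) (ω : ℕ → ℚ × ℚ) => h (ω i)) P :=
    iIndepFun_infinitePi (X := fun _ => h) fun _ => .of_discrete
  have hLp := strong_law_Lp (μ := P) le_rfl ENNReal.one_ne_top
    (fun (i : ℕ) (ω : ℕ → ℚ × ℚ) => h (ω i)) (memLp_one_iff_integrable.2 (integrable_eval μ hh 0))
    (fun i j hij => hI.indepFun hij)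
    (fun i => ⟨(hmeas i).aemeasurable, (hmeas 0).aemeasurable, by
      have hc : ∀ j : ℕ, P.map (fun ω => h (ω j)) = μ.map h := fun j => by
        rw [← Measure.infinitePi_map_eval (fun _ : ℕ => μ) j]
        exact (Measure.map_map (g := h) (.of_discrete) (measurable_pi_apply j)).symm
      rw [hc, hc]⟩)
  have hev := hLp.eventually_le_const (ENNReal.ofReal_pos.2 hδ)
  filter_upwards [hev, eventually_gt_atTop 0] with n hn hn0
  have hnR : (0 : ℝ) < n := by exact_mod_cast hn0
  rw [integral_eval μ h 0, h0, eLpNorm_one_eq_lintegral_enorm] at hn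
  have hintegr : Integrable (fun ω : ℕ → ℚ × ℚ => (n : ℝ)⁻¹ •
      ∑ i ∈ Finset.range n, h (ω i) - 0) P := by
    simp only [sub_zero]
    exact (integrable_finsetSum _ fun i _ => integrable_eval μ hh i).smul (n : ℝ)⁻¹
  rw [← ofReal_integral_norm_eq_lintegral_enorm hintegr, ENNReal.ofReal_le_ofReal_iff hδ.le] at hn
  simp only [sub_zero, norm_smul, norm_inv, Real.norm_eq_abs, Nat.abs_cast] at hn
  rw [integral_const_mul, inv_mul_le_iff₀ hnR] at hn
  linarith

/-- Block decomposition of the fluctuations of the partial sums of `x`, with `y ≥ 0`. -/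
lemma add_abs_sum_sub_sum_le (x y : ℕ → ℝ) (hy : ∀ i, 0 ≤ y i) (c : ℝ) {m l k : ℕ}
    (hk : k < m * l) :
    y k + |∑ i ∈ Finset.range (m * l), x i - ∑ i ∈ Finset.range (k + 1), x i| ≤
      c * l + 2 * ∑ q ∈ Finset.range (m + 1), |∑ i ∈ Finset.range (q * l), (|x i| + y i - c)|
        + 2 * ∑ q ∈ Finset.range (m + 1), |∑ i ∈ Finset.range (q * l), x i| := by
  have hl : 0 < l := Nat.pos_of_ne_zero fun h => by simp [h] at hk
  obtain ⟨q, hq1, hq2, hqm⟩ : ∃ q, q * l ≤ k ∧ k < (q + 1) * l ∧ q < m :=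
    ⟨k / l, Nat.div_mul_le_self k l, by
      rw [add_mul, one_mul]; exact Nat.lt_div_mul_add hl, (Nat.div_lt_iff_lt_mul hl).2 hk⟩
  set S : ℕ → ℝ := fun n => ∑ i ∈ Finset.range n, x i with hS
  set U : ℕ → ℝ := fun n => ∑ i ∈ Finset.range n, (|x i| + y i - c) with hU
  have hSd : S (k + 1) - S (q * l) = ∑ i ∈ Finset.Ico (q * l) (k + 1), x i :=
    (Finset.sum_Ico_eq_sub _ (by omega)).symm
  have hUd : U ((q + 1) * l) - U (q * l) + c * l =
      ∑ i ∈ Finset.Ico (q * l) ((q + 1) * l), (|x i| + y i) := by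
    rw [hU, ← Finset.sum_Ico_eq_sub _ (by omega), Finset.sum_sub_distrib, Finset.sum_const,
      Nat.card_Ico, add_mul, one_mul, Nat.add_sub_cancel_left, nsmul_eq_mul]
    ring
  have hblock : y k + |S (k + 1) - S (q * l)| ≤ U ((q + 1) * l) - U (q * l) + c * l := by
    rw [hSd, hUd]
    have hsub : Finset.Ico (q * l) (k + 1) ⊆ Finset.Ico (q * l) ((q + 1) * l) :=
      Finset.Ico_subset_Ico le_rfl hq2
    refine le_trans ?_ (Finset.sum_le_sum_of_subset_of_nonneg hsub fun i _ _ =>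
      add_nonneg (abs_nonneg _) (hy i))
    rw [Finset.sum_add_distrib, add_comm]
    exact add_le_add (Finset.abs_sum_le_sum_abs _ _)
      (Finset.single_le_sum (fun i _ => hy i) (by simp; omega))
  have hsum : ∀ (V : ℕ → ℝ) (j : ℕ), j ≤ m →
      |V (j * l)| ≤ ∑ q ∈ Finset.range (m + 1), |V (q * l)| := fun V j hj =>
    Finset.single_le_sum (f := fun q => |V (q * l)|) (fun q _ => abs_nonneg _)
      (Finset.mem_range.2 (by omega))
  have h1 := hsum U (q + 1) (by omega)
  have h2 := hsum U q (by omega)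
  have h3 := hsum S q (by omega)
  have h4 := hsum S m le_rfl
  have h5 : |S (m * l) - S (k + 1)| ≤ |S (m * l)| + |S (k + 1) - S (q * l)| + |S (q * l)| := by
    have e : S (m * l) - S (k + 1) = S (m * l) - (S (k + 1) - S (q * l)) - S (q * l) := by ring
    rw [e]
    exact (abs_sub _ _).trans (add_le_add (abs_sub _ _) le_rfl)
  have h6 := le_abs_self (U ((q + 1) * l))
  have h7 := neg_abs_le (U (q * l))
  show y k + |S (m * l) - S (k + 1)| ≤ c * l + 2 * ∑ q ∈ Finset.range (m + 1), |U (q * l)| +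
    2 * ∑ q ∈ Finset.range (m + 1), |S (q * l)|
  linarith

variable {μ}
variable (v : AbsoluteValue ℚ ℝ)

lemma log_affWalk_fst {ω : ℕ → ℚ × ℚ} (hω : ∀ i, (ω i).1 ≠ 0) (n : ℕ) :
    (affWalk ω n).1 ≠ 0 ∧
      Real.log (v (affWalk ω n).1) = ∑ i ∈ Finset.range n, Real.log (v (ω i).1) := by
  induction n with
  | zero => simp [affWalk]
  | succ n ih =>
    refine ⟨mul_ne_zero (hω n) ih.1, ?_⟩
    rw [Finset.sum_range_succ, ← ih.2, affWalk, affMul, v.map_mul,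
      Real.log_mul (v.ne_zero (hω n)) (v.ne_zero ih.1), add_comm]

lemma apply_affWalk_snd_le {ω : ℕ → ℚ × ℚ} (hω : ∀ i, (ω i).1 ≠ 0) (n : ℕ) :
    v (affWalk ω n).2 ≤ ∑ k ∈ Finset.range n, v (ω k).2 *
      Real.exp (∑ i ∈ Finset.range n, Real.log (v (ω i).1) -
        ∑ i ∈ Finset.range (k + 1), Real.log (v (ω i).1)) := by
  induction n with
  | zero => simp [affWalk]
  | succ n ih =>
    rw [Finset.sum_range_succ _ n, sub_self, Real.exp_zero, mul_one, affWalk, affMul]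
    refine (v.add_le _ _).trans (add_le_add ?_ le_rfl)
    rw [v.map_mul]
    refine (mul_le_mul_of_nonneg_left ih (v.nonneg _)).trans (le_of_eq ?_)
    rw [Finset.mul_sum]
    refine Finset.sum_congr rfl fun k _ => ?_
    rw [Finset.sum_range_succ _ n, add_sub_right_comm, Real.exp_add,
      Real.exp_log (v.pos (hω n))]
    ring

lemma posLog_apply_affWalk_snd_le {ω : ℕ → ℚ × ℚ} (hω : ∀ i, (ω i).1 ≠ 0) {n : ℕ} {B : ℝ}
    (hB0 : 0 ≤ B)
    (hB : ∀ k < n, Real.posLog (v (ω k).2) + |∑ i ∈ Finset.range n, Real.log (v (ω i).1) -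
        ∑ i ∈ Finset.range (k + 1), Real.log (v (ω i).1)| ≤ B) :
    Real.posLog (v (affWalk ω n).2) ≤ Real.log n + B := by
  rcases Nat.eq_zero_or_pos n with rfl | hn
  · simpa [affWalk] using hB0
  have hle : v (affWalk ω n).2 ≤ n * Real.exp B := by
    refine (apply_affWalk_snd_le v hω n).trans ?_
    have : ∀ k ∈ Finset.range n, v (ω k).2 *
        Real.exp (∑ i ∈ Finset.range n, Real.log (v (ω i).1) -
          ∑ i ∈ Finset.range (k + 1), Real.log (v (ω i).1)) ≤ Real.exp B := by
      intro k hk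
      have h1 : v (ω k).2 ≤ Real.exp (Real.posLog (v (ω k).2)) :=
        (Real.le_exp_log _).trans (Real.exp_le_exp.2 (le_max_right _ _))
      refine (mul_le_mul_of_nonneg_right h1 (Real.exp_pos _).le).trans ?_
      rw [← Real.exp_add]
      exact Real.exp_le_exp.2 ((add_le_add le_rfl (le_abs_self _)).trans
        (hB k (Finset.mem_range.1 hk)))
    simpa using Finset.sum_le_card_nsmul _ _ _ this
  refine (Real.posLog_le_posLog (v.nonneg _) hle).trans (Real.posLog_nat_mul.trans ?_)
  rw [Real.posLog, Real.log_exp, max_eq_right hB0]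

/-- A bound for the size of `affWalk ω (m * l)` at the place `v` by partial sums along
multiples of `l`. -/
lemma affWalk_gauge_le {ω : ℕ → ℚ × ℚ} (hω : ∀ i, (ω i).1 ≠ 0) {c : ℝ} (hc : 0 ≤ c) (m l : ℕ) :
    |Real.log (v (affWalk ω (m * l)).1)| + Real.posLog (v (affWalk ω (m * l)).2) ≤
      Real.log (m * l : ℕ) + c * l +
      2 * ∑ q ∈ Finset.range (m + 1), |∑ i ∈ Finset.range (q * l),
        (|Real.log (v (ω i).1)| + Real.posLog (v (ω i).2) - c)| +
      3 * ∑ q ∈ Finset.range (m + 1), |∑ i ∈ Finset.range (q * l), Real.log (v (ω i).1)| := by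
  have h := posLog_apply_affWalk_snd_le v hω (n := m * l) (B := c * l +
    2 * ∑ q ∈ Finset.range (m + 1), |∑ i ∈ Finset.range (q * l),
        (|Real.log (v (ω i).1)| + Real.posLog (v (ω i).2) - c)| +
    2 * ∑ q ∈ Finset.range (m + 1), |∑ i ∈ Finset.range (q * l), Real.log (v (ω i).1)|)
    (by positivity)
    (fun k hk => add_abs_sum_sub_sum_le (fun i => Real.log (v (ω i).1))
      (fun i => Real.posLog (v (ω i).2)) (fun i => Real.posLog_nonneg) c hk)
  have h2 : |∑ i ∈ Finset.range (m * l), Real.log (v (ω i).1)| ≤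
      ∑ q ∈ Finset.range (m + 1), |∑ i ∈ Finset.range (q * l), Real.log (v (ω i).1)| :=
    Finset.single_le_sum (f := fun q => |∑ i ∈ Finset.range (q * l), Real.log (v (ω i).1)|)
      (fun q _ => abs_nonneg _) (Finset.mem_range.2 (Nat.lt_succ_self m))
  rw [(log_affWalk_fst v hω _).2]
  linarith

lemma ae_path {p : ℚ × ℚ → Prop} (hp : ∀ᵐ g ∂μ, p g) :
    ∀ᵐ ω : ℕ → ℚ × ℚ ∂(Measure.infinitePi fun _ => μ), ∀ i, p (ω i) :=
  ae_all_iff.2 fun i =>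
    (measurePreserving_eval_infinitePi (fun _ : ℕ => μ) i).quasiMeasurePreserving.ae hp

variable (hne : ∀ᵐ g ∂μ, g.1 ≠ 0) (ha : Integrable (fun g : ℚ × ℚ => Real.log (v g.1)) μ)
  (hb : Integrable (fun g : ℚ × ℚ => Real.posLog (v g.2)) μ)

include hne ha hb

lemma integrable_and_integral_affPow_gauge_le (m l : ℕ) {c : ℝ} (hc : 0 ≤ c) :
    Integrable (fun g : ℚ × ℚ => |Real.log (v g.1)| + Real.posLog (v g.2)) (affPow μ (m * l)) ∧
    ∫ g, (|Real.log (v g.1)| + Real.posLog (v g.2)) ∂(affPow μ (m * l)) ≤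
      Real.log (m * l : ℕ) + c * l +
      2 * ∑ q ∈ Finset.range (m + 1), ∫ ω : ℕ → ℚ × ℚ, |∑ i ∈ Finset.range (q * l),
        (|Real.log (v (ω i).1)| + Real.posLog (v (ω i).2) - c)|
          ∂(Measure.infinitePi fun _ => μ) +
      3 * ∑ q ∈ Finset.range (m + 1), ∫ ω : ℕ → ℚ × ℚ,
        |∑ i ∈ Finset.range (q * l), Real.log (v (ω i).1)| ∂(Measure.infinitePi fun _ => μ) := by
  have hle := (ae_path hne).mono fun ω hω => affWalk_gauge_le v hω hc m l
  have hU : ∀ q ∈ Finset.range (m + 1), Integrable (fun ω : ℕ → ℚ × ℚ =>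
      |∑ i ∈ Finset.range (q * l), (|Real.log (v (ω i).1)| + Real.posLog (v (ω i).2) - c)|)
      (Measure.infinitePi fun _ => μ) := fun q _ =>
    (integrable_finsetSum _ fun i _ => integrable_eval μ
      ((ha.abs.add hb).sub (integrable_const c)) i).abs
  have hS : ∀ q ∈ Finset.range (m + 1), Integrable (fun ω : ℕ → ℚ × ℚ =>
      |∑ i ∈ Finset.range (q * l), Real.log (v (ω i).1)|) (Measure.infinitePi fun _ => μ) :=
    fun q _ => (integrable_finsetSum _ fun i _ => integrable_eval μ ha i).abs
  have hU' := (integrable_finsetSum _ hU).const_mul 2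
  have hS' := (integrable_finsetSum _ hS).const_mul 3
  have hconst : Integrable (fun _ : ℕ → ℚ × ℚ => Real.log (m * l : ℕ) + c * l)
      (Measure.infinitePi fun _ => μ) := integrable_const _
  have hconstU := hconst.add hU'
  have hbound := hconstU.add hS'
  have hintegr : Integrable (fun ω : ℕ → ℚ × ℚ => |Real.log (v (affWalk ω (m * l)).1)| +
      Real.posLog (v (affWalk ω (m * l)).2)) (Measure.infinitePi fun _ => μ) := by
    refine hbound.mono' (((Measurable.of_discrete (f := fun g : ℚ × ℚ =>
      |Real.log (v g.1)| + Real.posLog (v g.2))).comp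
        (measurable_affWalk (m * l))).aestronglyMeasurable) ?_
    filter_upwards [hle] with ω hω
    rw [Real.norm_eq_abs, abs_of_nonneg (add_nonneg (abs_nonneg _) Real.posLog_nonneg)]
    exact hω
  rw [← map_affWalk μ (m * l), integrable_map_measure (Measurable.of_discrete).aestronglyMeasurable
    (measurable_affWalk _).aemeasurable, integral_map (measurable_affWalk _).aemeasurable
    (Measurable.of_discrete).aestronglyMeasurable]
  refine ⟨hintegr, (integral_mono_ae hintegr hbound hle).trans (le_of_eq ?_)⟩
  rw [integral_add' hconstU hS', integral_add' hconst hU', integral_const, integral_const_mul,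
    integral_const_mul, integral_finsetSum _ hU, integral_finsetSum _ hS]
  simp

lemma integrable_affPow_gauge (n : ℕ) :
    Integrable (fun g : ℚ × ℚ => |Real.log (v g.1)| + Real.posLog (v g.2)) (affPow μ n) := by
  simpa using (integrable_and_integral_affPow_gauge_le v hne ha hb 1 n le_rfl).1

/-- The expected size of the random walk at a place with zero drift grows sublinearly. -/
lemma eventually_integral_affPow_gauge_le (h0 : ∫ g, Real.log (v g.1) ∂μ = 0) {ε : ℝ}
    (hε : 0 < ε) : ∀ᶠ m : ℕ in atTop, ∀ᶠ l : ℕ in atTop,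
    ∫ g, (|Real.log (v g.1)| + Real.posLog (v g.2)) ∂(affPow μ (m * l)) ≤ ε * (m * l : ℕ) := by
  set y : ℚ × ℚ → ℝ := fun g => |Real.log (v g.1)| + Real.posLog (v g.2) with hy
  set c : ℝ := ∫ g, y g ∂μ with hc
  have hc0 : 0 ≤ c := integral_nonneg fun g => add_nonneg (abs_nonneg _) Real.posLog_nonneg
  have hyint : Integrable y μ := ha.abs.add hb
  have hu : Integrable (fun g => y g - c) μ := hyint.sub (integrable_const c)
  have hu0 : ∫ g, (y g - c) ∂μ = 0 := by
    rw [integral_sub hyint (integrable_const c), ← hc]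
    simp
  have hm : ∀ᶠ m : ℕ in atTop, c / m ≤ ε / 2 :=
    (tendsto_const_div_atTop_nhds_zero_nat c).eventually_le_const (half_pos hε)
  filter_upwards [hm, eventually_gt_atTop 0] with m hm hm0
  have hmR : (0 : ℝ) < m := by exact_mod_cast hm0
  set δ : ℝ := ε / 2 / (1 + 5 * (m + 1)) with hδ
  have hδ0 : 0 < δ := by positivity
  have hsums : ∀ h : ℚ × ℚ → ℝ, Integrable h μ → ∫ g, h g ∂μ = 0 → ∀ᶠ l : ℕ in atTop,
      ∀ q ∈ Finset.range (m + 1), ∫ ω : ℕ → ℚ × ℚ, |∑ i ∈ Finset.range (q * l), h (ω i)|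
        ∂(Measure.infinitePi fun _ => μ) ≤ δ * (m * l : ℕ) := by
    intro h hh hh0
    refine (Finset.eventually_all _).2 fun q hq => ?_
    rcases Nat.eq_zero_or_pos q with rfl | hq0
    · refine Eventually.of_forall fun l => ?_
      simp only [zero_mul, Finset.range_zero, Finset.sum_empty, abs_zero, integral_zero]
      positivity
    · have ht : Tendsto (fun l => q * l) atTop atTop :=
        tendsto_id.const_mul_atTop' hq0
      filter_upwards [ht.eventually (eventually_integral_abs_sum_le μ hh hh0 hδ0)] with l hl
      refine hl.trans (mul_le_mul_of_nonneg_left ?_ hδ0.le)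
      exact_mod_cast Nat.mul_le_mul_right l (Nat.lt_succ_iff.1 (Finset.mem_range.1 hq))
  have hlog : ∀ᶠ l : ℕ in atTop, Real.log (m * l : ℕ) ≤ δ * (m * l : ℕ) := by
    have ht : Tendsto (fun l : ℕ => ((m * l : ℕ) : ℝ)) atTop atTop :=
      tendsto_natCast_atTop_atTop.comp (tendsto_id.const_mul_atTop' hm0)
    have := ht.eventually (Real.isLittleO_log_id_atTop.def hδ0)
    filter_upwards [this] with l hl
    refine (le_abs_self _).trans (hl.trans (le_of_eq ?_))
    simp
  filter_upwards [hsums _ hu hu0, hsums _ ha h0, hlog] with l h1 h2 h3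
  refine (integrable_and_integral_affPow_gauge_le v hne ha hb m l hc0).2.trans ?_
  have h4 := Finset.sum_le_card_nsmul _ _ _ h1
  have h5 := Finset.sum_le_card_nsmul _ _ _ h2
  simp only [Finset.card_range, nsmul_eq_mul, Nat.cast_add, Nat.cast_one] at h4 h5
  have h6 : c * l ≤ ε / 2 * (m * l : ℕ) := by
    rw [div_le_iff₀ hmR] at hm
    push_cast
    calc c * l ≤ (ε / 2 * m) * l := mul_le_mul_of_nonneg_right hm (Nat.cast_nonneg l)
      _ = _ := by ring
  have h7 : δ * (1 + 5 * (m + 1)) = ε / 2 := by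
    rw [hδ]
    field_simp
  have h8 : (δ * (1 + 5 * (m + 1))) * (m * l : ℕ) = ε / 2 * (m * l : ℕ) := by rw [h7]
  linarith

end PathSpace

section Heights

/-- The additive height of a rational number. -/
noncomputable def ratHeight (a : ℚ) : ℝ := Real.log (1 + |(a.num : ℝ)|) + Real.log a.den

lemma ratHeight_nonneg (a : ℚ) : 0 ≤ ratHeight a :=
  add_nonneg (Real.log_nonneg (by linarith [abs_nonneg (a.num : ℝ)])) (Real.log_natCast_nonneg _)

lemma exp_neg_two_mul_ratHeight (a : ℚ) :
    Real.exp (-2 * ratHeight a) = 1 / (1 + |(a.num : ℝ)|) ^ 2 * (1 / (a.den : ℝ) ^ 2) := by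
  have h1 : 0 < 1 + |(a.num : ℝ)| := by positivity
  have h2 : (0 : ℝ) < a.den := by exact_mod_cast a.den_pos
  rw [ratHeight, neg_mul, Real.exp_neg, mul_add, Real.exp_add, ← Nat.cast_ofNat (R := ℝ) (n := 2),
    Real.exp_nat_mul, Real.exp_nat_mul, Real.exp_log h1, Real.exp_log h2, mul_inv, one_div, one_div]

lemma summable_exp_neg_ratHeight : Summable fun a : ℚ => Real.exp (-2 * ratHeight a) := by
  have hZ : Summable fun n : ℤ => 1 / (1 + |(n : ℝ)|) ^ 2 := by
    refine Summable.of_nonneg_of_le (fun n => by positivity) (fun n => ?_)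
      ((Real.summable_one_div_int_add_rpow (1 / 2) 2).2 one_lt_two)
    have hpos : 0 < |(n : ℝ) + 1 / 2| := by
      refine abs_pos.2 fun h => ?_
      have h2 : (2 * n + 1 : ℤ) = 0 := by
        have : (2 * n + 1 : ℝ) = 0 := by linarith
        exact_mod_cast this
      omega
    rw [Real.rpow_two]
    refine one_div_le_one_div_of_le (pow_pos hpos 2) (pow_le_pow_left₀ hpos.le ?_ 2)
    refine (abs_add_le _ _).trans ?_
    rw [abs_of_pos (by norm_num : (0 : ℝ) < 1 / 2)]
    linarith
  have hN : Summable fun n : ℕ => 1 / (n : ℝ) ^ 2 := Real.summable_one_div_nat_pow.2 one_lt_two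
  have hprod := hZ.mul_of_nonneg hN (fun n => by positivity) (fun n => by positivity)
  have hinj : Function.Injective fun a : ℚ => (a.num, a.den) := fun a b h => by
    simp only [Prod.mk.injEq] at h
    exact Rat.ext h.1 h.2
  exact (hprod.comp_injective hinj).congr fun a => (exp_neg_two_mul_ratHeight a).symm

/-- An explicit upper bound for the entropy of measures on pairs of rational numbers. -/
lemma exists_shannonEntropy_le : ∃ C : ℝ, ∀ (ν : Measure (ℚ × ℚ)) [IsProbabilityMeasure ν],
    Integrable (fun g : ℚ × ℚ => ratHeight g.1 + ratHeight g.2) ν →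
    Integrable (fun g => Real.log (ν.real {g})) ν ∧
      shannonEntropy ν ≤ C + 2 * ∫ g, (ratHeight g.1 + ratHeight g.2) ∂ν := by
  have hs := summable_exp_neg_ratHeight.mul_of_nonneg summable_exp_neg_ratHeight
    (fun a => (Real.exp_pos _).le) (fun a => (Real.exp_pos _).le)
  set T : ℝ := ∑' g : ℚ × ℚ, Real.exp (-2 * ratHeight g.1) * Real.exp (-2 * ratHeight g.2) with hT
  have hT0 : 0 < T := hs.tsum_pos (fun g => by positivity) (0, 0) (by positivity)
  refine ⟨Real.log T, fun ν _ hν => ?_⟩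
  set q : ℚ × ℚ → ℝ := fun g => Real.exp (-2 * (ratHeight g.1 + ratHeight g.2) - Real.log T) with hq
  have hqT : ∀ g : ℚ × ℚ, q g =
      Real.exp (-2 * ratHeight g.1) * Real.exp (-2 * ratHeight g.2) / T := fun g => by
    change Real.exp (-2 * (ratHeight g.1 + ratHeight g.2) - Real.log T) = _
    rw [Real.exp_sub, mul_add, Real.exp_add, Real.exp_log hT0]
  have hsum : ∑' g, ENNReal.ofReal (q g) ≤ 1 := by
    rw [← ENNReal.ofReal_tsum_of_nonneg (fun g => (Real.exp_pos _).le)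
      ((hs.div_const T).congr fun g => (hqT g).symm), tsum_congr hqT, tsum_div_const, ← hT,
      div_self hT0.ne', ENNReal.ofReal_one]
  have hlogq : ∀ g, Real.log (q g) = -2 * (ratHeight g.1 + ratHeight g.2) - Real.log T :=
    fun g => Real.log_exp _
  have hintegr : Integrable (fun g => Real.log (q g)) ν := by
    simp_rw [hlogq]
    exact (hν.const_mul (-2)).sub (integrable_const _)
  have h := gibbs_inequality ν q hsum (Eventually.of_forall fun g => Real.exp_pos _) hintegr
  refine ⟨h.1, h.2.trans (le_of_eq ?_)⟩
  simp_rw [hlogq]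
  rw [integral_sub (hν.const_mul (-2)) (integrable_const _), integral_const_mul]
  simp

lemma posLog_le_abs_log (x : ℝ) : Real.posLog x ≤ |Real.log x| :=
  max_le (abs_nonneg _) (le_abs_self _)

lemma neg_log_den_le_log_abs {a : ℚ} (ha : a ≠ 0) : -Real.log a.den ≤ Real.log |(a : ℝ)| := by
  have hd : (0 : ℝ) < a.den := by exact_mod_cast a.den_pos
  have hn : (1 : ℝ) ≤ |(a.num : ℝ)| := by
    exact_mod_cast Int.one_le_abs (Rat.num_ne_zero.2 ha)
  rw [← Real.log_inv]
  refine Real.log_le_log (inv_pos.2 hd) ?_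
  rw [Rat.cast_def, abs_div, abs_of_pos hd, inv_eq_one_div]
  exact div_le_div_of_nonneg_right hn hd.le

lemma ratHeight_le (a : ℚ) :
    ratHeight a ≤ Real.log 2 + Real.posLog |(a : ℝ)| + 2 * Real.log a.den := by
  have hd : (1 : ℝ) ≤ a.den := by exact_mod_cast a.den_pos
  have hd0 : (0 : ℝ) < a.den := by linarith
  have hm : (0 : ℝ) < max 1 |(a : ℝ)| := lt_max_of_lt_left one_pos
  have hnum : |(a.num : ℝ)| = |(a : ℝ)| * a.den := by
    rw [Rat.cast_def, abs_div, abs_of_pos hd0, div_mul_cancel₀ _ hd0.ne']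
  have hle : 1 + |(a.num : ℝ)| ≤ 2 * max 1 |(a : ℝ)| * a.den := by
    rw [hnum]
    nlinarith [le_max_left 1 |(a : ℝ)|, le_max_right 1 |(a : ℝ)|,
      mul_le_mul_of_nonneg_right (le_max_right 1 |(a : ℝ)|) hd0.le,
      mul_le_mul (le_max_left 1 |(a : ℝ)|) hd zero_le_one hm.le]
  have := Real.log_le_log (by positivity) hle
  rw [Real.log_mul (by positivity) hd0.ne', Real.log_mul two_ne_zero hm.ne',
    ← Real.posLog_eq_log_max_one (abs_nonneg _)] at this
  rw [ratHeight]
  linarith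

end Heights

section Arithmetic

lemma factorization_den_mul_log_le (p : ℕ) [Fact p.Prime] (b : ℚ) :
    b.den.factorization p * Real.log p ≤ Real.posLog (Rat.AbsoluteValue.padic p b) := by
  have hp : p.Prime := Fact.out
  by_cases hd : p ∣ b.den
  · have hb : b ≠ 0 := by
      rintro rfl
      exact hp.one_lt.ne' (Nat.dvd_one.1 (by simpa using hd))
    have hnum : ¬ p ∣ b.num.natAbs := fun hn =>
      hp.one_lt.ne' (Nat.dvd_one.1 (b.reduced ▸ Nat.dvd_gcd hn hd))
    have hval : padicValRat p b = -(b.den.factorization p : ℤ) := by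
      rw [padicValRat, padicValInt, padicValNat.eq_zero_of_not_dvd hnum,
        Nat.factorization_def _ hp]
      simp
    rw [Rat.AbsoluteValue.padic_eq_padicNorm, padicNorm.eq_zpow_of_nonzero hb, hval, neg_neg]
    push_cast
    rw [zpow_natCast, Real.posLog_pow, Real.log_of_nat_eq_posLog]
  · rw [Nat.factorization_eq_zero_of_not_dvd hd]
    simpa using Real.posLog_nonneg

variable {ι : Type} [Fintype ι] {pr : ι → ℕ}

lemma mem_ZP_of_eq_div (h : ℤ) (k : ι → ℕ) : (h : ℚ) / (∏ i, pr i ^ k i : ℕ) ∈ ZP pr := by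
  refine ⟨h, fun i => -(k i : ℤ), ?_⟩
  push_cast
  simp_rw [zpow_neg, zpow_natCast, Finset.prod_inv_distrib, div_eq_mul_inv]

section

variable [∀ i, Fact (pr i).Prime]

lemma prod_zpow_ne_zero (k : ι → ℤ) : ∏ i, (pr i : ℚ) ^ (k i) ≠ 0 :=
  Finset.prod_ne_zero_iff.2 fun i _ =>
    zpow_ne_zero _ (Nat.cast_ne_zero.2 (Fact.out : (pr i).Prime).ne_zero)

lemma exists_nat_pow_eq_of_mem_ZP {b : ℚ} (hb : b ∈ ZP pr) :
    ∃ (h : ℤ) (k : ι → ℕ), b = h / (∏ i, pr i ^ k i : ℕ) := by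
  obtain ⟨h, k, rfl⟩ := hb
  have hne : ∀ i, (pr i : ℚ) ≠ 0 := fun i =>
    Nat.cast_ne_zero.2 (Fact.out : (pr i).Prime).ne_zero
  refine ⟨h * ∏ i, (pr i : ℤ) ^ (k i).toNat, fun i => (-k i).toNat, ?_⟩
  push_cast
  rw [mul_div_assoc, ← Finset.prod_div_distrib]
  congr 1
  refine Finset.prod_congr rfl fun i _ => ?_
  rw [← zpow_natCast, ← zpow_natCast, ← zpow_sub₀ (hne i)]
  congr 1
  omega

lemma add_mem_ZP {b c : ℚ} (hb : b ∈ ZP pr) (hc : c ∈ ZP pr) : b + c ∈ ZP pr := by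
  obtain ⟨h, k, rfl⟩ := exists_nat_pow_eq_of_mem_ZP hb
  obtain ⟨h', k', rfl⟩ := exists_nat_pow_eq_of_mem_ZP hc
  have hne : ∀ k : ι → ℕ, ((∏ i, pr i ^ k i : ℕ) : ℚ) ≠ 0 := fun k =>
    Nat.cast_ne_zero.2 (Finset.prod_ne_zero_iff.2 fun i _ =>
      pow_ne_zero _ (Fact.out : (pr i).Prime).ne_zero)
  have hmul : (∏ i, pr i ^ (k i + k' i) : ℕ) = (∏ i, pr i ^ k i) * ∏ i, pr i ^ k' i := by
    simp_rw [pow_add, Finset.prod_mul_distrib]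
  convert mem_ZP_of_eq_div (pr := pr)
    (h * (∏ i, pr i ^ k' i : ℕ) + (∏ i, pr i ^ k i : ℕ) * h') (fun i => k i + k' i) using 1
  rw [hmul, div_add_div _ _ (hne k) (hne k')]
  push_cast
  ring

lemma mul_mem_MP {a b : ℚ} (ha : a ∈ MP pr) (hb : b ∈ MP pr) : a * b ∈ MP pr := by
  obtain ⟨s, k, hs, rfl⟩ := ha
  obtain ⟨s', k', hs', rfl⟩ := hb
  refine ⟨s * s', fun i => k i + k' i, ?_, ?_⟩
  · rcases hs with rfl | rfl <;> rcases hs' with rfl | rfl <;> simp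
  · simp_rw [zpow_add₀ (Nat.cast_ne_zero.2 (Fact.out : (pr _).Prime).ne_zero : (pr _ : ℚ) ≠ 0),
      Finset.prod_mul_distrib]
    ring

lemma mul_mem_ZP {a b : ℚ} (ha : a ∈ MP pr) (hb : b ∈ ZP pr) : a * b ∈ ZP pr := by
  obtain ⟨s, k, hs, rfl⟩ := ha
  obtain ⟨h, k', rfl⟩ := hb
  have hprod : ∏ i, (pr i : ℚ) ^ (k i + k' i) =
      (∏ i, (pr i : ℚ) ^ k i) * ∏ i, (pr i : ℚ) ^ k' i := by
    simp_rw [zpow_add₀ (Nat.cast_ne_zero.2 (Fact.out : (pr _).Prime).ne_zero : (pr _ : ℚ) ≠ 0),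
      Finset.prod_mul_distrib]
  rcases hs with rfl | rfl
  · exact ⟨h, fun i => k i + k' i, by rw [hprod]; ring⟩
  · exact ⟨-h, fun i => k i + k' i, by rw [hprod]; push_cast; ring⟩

lemma ne_zero_of_mem_MP_s17 {a : ℚ} (ha : a ∈ MP pr) : a ≠ 0 := by
  obtain ⟨s, k, hs, rfl⟩ := ha
  refine mul_ne_zero ?_ (prod_zpow_ne_zero k)
  rcases hs with rfl | rfl <;> norm_num

end

lemma one_mem_MP : (1 : ℚ) ∈ MP pr := ⟨1, 0, by simp⟩

lemma zero_mem_ZP : (0 : ℚ) ∈ ZP pr := ⟨0, 0, by simp⟩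

lemma mem_ZP_of_mem_MP {a : ℚ} (ha : a ∈ MP pr) : a ∈ ZP pr := by
  obtain ⟨s, k, rfl | rfl, rfl⟩ := ha
  · exact ⟨1, k, by simp⟩
  · exact ⟨-1, k, by simp⟩

lemma inv_mem_MP {a : ℚ} (ha : a ∈ MP pr) : a⁻¹ ∈ MP pr := by
  obtain ⟨s, k, hs, rfl⟩ := ha
  refine ⟨s, fun i => -k i, hs, ?_⟩
  simp_rw [zpow_neg, Finset.prod_inv_distrib, mul_inv]
  rcases hs with rfl | rfl <;> norm_num

variable [∀ i, Fact (pr i).Prime]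

lemma affMul_mem_AffSet : ∀ g ∈ AffSet pr, ∀ h ∈ AffSet pr, affMul g h ∈ AffSet pr :=
  fun _ hg _ hh => ⟨mul_mem_MP hg.1 hh.1, add_mem_ZP (mul_mem_ZP hg.1 hh.2) hg.2⟩

lemma log_den_le_of_mem_ZP (hinj : Function.Injective pr) {b : ℚ} (hb : b ∈ ZP pr) :
    Real.log b.den ≤ ∑ i, Real.posLog (Rat.AbsoluteValue.padic (pr i) b) := by
  classical
  obtain ⟨h, k, hbk⟩ := exists_nat_pow_eq_of_mem_ZP hb
  have hdvd : b.den ∣ ∏ i, pr i ^ k i := by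
    have := Rat.den_dvd h (∏ i, pr i ^ k i : ℕ)
    rw [Rat.divInt_eq_div, Int.cast_natCast, ← hbk] at this
    exact_mod_cast this
  have hsub : b.den.primeFactors ⊆ Finset.univ.image pr := by
    intro p hp
    have hpp := Nat.prime_of_mem_primeFactors hp
    obtain ⟨i, -, hi⟩ := (hpp.prime.dvd_finsetProd_iff _).1
      ((Nat.dvd_of_mem_primeFactors hp).trans hdvd)
    have := (Nat.prime_dvd_prime_iff_eq hpp Fact.out).1 (hpp.dvd_of_dvd_pow hi)
    exact Finset.mem_image.2 ⟨i, Finset.mem_univ _, this.symm⟩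
  calc Real.log b.den
      = ∑ p ∈ b.den.primeFactors, b.den.factorization p * Real.log p := by
        conv_lhs => rw [← Nat.prod_factorization_pow_eq_self b.den_nz]
        rw [Finsupp.prod, Nat.support_factorization, Nat.cast_prod, Real.log_prod]
        · simp
        · intro p hp
          exact Nat.cast_ne_zero.2 (pow_ne_zero _ (Nat.prime_of_mem_primeFactors hp).ne_zero)
    _ ≤ ∑ p ∈ Finset.univ.image pr, b.den.factorization p * Real.log p :=
        Finset.sum_le_sum_of_subset_of_nonneg hsub fun p _ _ =>
          mul_nonneg (Nat.cast_nonneg _) (Real.log_natCast_nonneg _)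
    _ = ∑ i, b.den.factorization (pr i) * Real.log (pr i) :=
        Finset.sum_image fun i _ j _ hij => hinj hij
    _ ≤ _ := Finset.sum_le_sum fun i _ => factorization_den_mul_log_le (pr i) b

lemma abs_log_abs_le_of_mem_MP (hinj : Function.Injective pr) {a : ℚ} (ha : a ∈ MP pr) :
    abs (Real.log |(a : ℝ)|) ≤ ∑ i, |Real.log (Rat.AbsoluteValue.padic (pr i) a)| := by
  have ha0 := ne_zero_of_mem_MP_s17 ha
  have h1 := neg_log_den_le_log_abs ha0
  have h2 := neg_log_den_le_log_abs (inv_ne_zero ha0)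
  rw [Rat.cast_inv, abs_inv, Real.log_inv] at h2
  have h3 := (log_den_le_of_mem_ZP hinj (mem_ZP_of_mem_MP ha)).trans
    (Finset.sum_le_sum fun i _ => posLog_le_abs_log _)
  have h4 := (log_den_le_of_mem_ZP hinj (mem_ZP_of_mem_MP (inv_mem_MP ha))).trans
    (Finset.sum_le_sum fun i _ => posLog_le_abs_log _)
  simp_rw [map_inv₀, Real.log_inv, abs_neg] at h4
  rw [abs_le]
  constructor <;> linarith

/-- The absolute values attached to `P ∪ {∞}`. -/
noncomputable def place (pr : ι → ℕ) [∀ i, Fact (pr i).Prime] : Option ι → AbsoluteValue ℚ ℝ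
  | none => Rat.AbsoluteValue.real
  | some i => Rat.AbsoluteValue.padic (pr i)

lemma ratHeight_add_ratHeight_le (hinj : Function.Injective pr) {g : ℚ × ℚ} (hg : g ∈ AffSet pr) :
    ratHeight g.1 + ratHeight g.2 ≤ 2 * Real.log 2 +
      2 * ∑ j, (|Real.log (place pr j g.1)| + Real.posLog (place pr j g.2)) := by
  have h1 := ratHeight_le g.1
  have h2 := ratHeight_le g.2
  have h3 := (log_den_le_of_mem_ZP hinj (mem_ZP_of_mem_MP hg.1)).trans
    (Finset.sum_le_sum fun i _ => posLog_le_abs_log _)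
  have h4 := log_den_le_of_mem_ZP hinj hg.2
  have h5 := posLog_le_abs_log |(g.1 : ℝ)|
  have h6 := abs_nonneg (Real.log |(g.1 : ℝ)|)
  have h7 : 0 ≤ Real.posLog |(g.2 : ℝ)| := Real.posLog_nonneg
  rw [Finset.sum_add_distrib, Fintype.sum_option, Fintype.sum_option]
  simp only [place, Rat.AbsoluteValue.real_eq_abs, Rat.cast_abs] at *
  linarith

end Arithmetic

section Liouville

lemma integral_log_place_eq_zero {ι : Type} {pr : ι → ℕ} [∀ i, Fact (pr i).Prime]
    {μ : Measure (ℚ × ℚ)} (hdriftInf : driftInf μ = 0) (hdrift : ∀ i, drift pr μ i = 0)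
    (j : Option ι) :
    ∫ g : ℚ × ℚ, Real.log (place pr j g.1) ∂μ = 0 := by
  cases j with
  | none =>
    simp only [place, Rat.AbsoluteValue.real_eq_abs, Rat.cast_abs]
    exact hdriftInf
  | some i => exact hdrift i

variable {ι : Type} [Fintype ι] {pr : ι → ℕ} [∀ i, Fact (pr i).Prime]
  {μ : Measure (ℚ × ℚ)}

lemma integrable_log_place (hinj : Function.Injective pr) (hμ : ∀ᵐ g ∂μ, g ∈ AffSet pr)
    (hmom : FirstMoment pr μ) (j : Option ι) :
    Integrable (fun g : ℚ × ℚ => Real.log (place pr j g.1)) μ := by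
  refine hmom.1.mono' Measurable.of_discrete.aestronglyMeasurable ?_
  filter_upwards [hμ] with g hg
  rw [Real.norm_eq_abs]
  cases j with
  | none =>
    have h := abs_log_abs_le_of_mem_MP hinj hg.1
    simp only [place, Rat.AbsoluteValue.real_eq_abs, Rat.cast_abs]
    exact h
  | some i =>
    exact Finset.single_le_sum (f := fun i => |Real.log (ratAbs (pr i) g.1)|)
      (fun i _ => abs_nonneg _) (Finset.mem_univ i)

lemma logPlus_eq_posLog (t : ℝ) : logPlus t = Real.posLog t := max_comm _ _

lemma integrable_posLog_place (hmom : FirstMoment pr μ) (j : Option ι) :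
    Integrable (fun g : ℚ × ℚ => Real.posLog (place pr j g.2)) μ := by
  refine hmom.2.mono' Measurable.of_discrete.aestronglyMeasurable (ae_of_all _ fun g => ?_)
  simp_rw [logPlus_eq_posLog]
  rw [Real.norm_eq_abs, abs_of_nonneg Real.posLog_nonneg]
  cases j with
  | none =>
    simp only [place, Rat.AbsoluteValue.real_eq_abs, Rat.cast_abs]
    exact le_add_of_nonneg_left (Finset.sum_nonneg fun i _ => Real.posLog_nonneg)
  | some i =>
    refine le_add_of_le_of_nonneg ?_ Real.posLog_nonneg
    exact Finset.single_le_sum (f := fun i => Real.posLog (ratAbs (pr i) g.2))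
      (fun i _ => Real.posLog_nonneg) (Finset.mem_univ i)

lemma ae_ne_zero_of_ae_mem_AffSet (hμ : ∀ᵐ g ∂μ, g ∈ AffSet pr) : ∀ᵐ g ∂μ, g.1 ≠ 0 :=
  hμ.mono fun _ hg => ne_zero_of_mem_MP_s17 hg.1

variable [IsProbabilityMeasure μ]

lemma integrable_affPow_ratHeight (hinj : Function.Injective pr)
    (hμ : ∀ᵐ g ∂μ, g ∈ AffSet pr) (hmom : FirstMoment pr μ) (n : ℕ) :
    Integrable (fun g : ℚ × ℚ => ratHeight g.1 + ratHeight g.2) (affPow μ n) ∧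
    ∫ g, (ratHeight g.1 + ratHeight g.2) ∂(affPow μ n) ≤ 2 * Real.log 2 + 2 * ∑ j,
      ∫ g, (|Real.log (place pr j g.1)| + Real.posLog (place pr j g.2)) ∂(affPow μ n) := by
  have hj : ∀ j ∈ Finset.univ, Integrable (fun g : ℚ × ℚ =>
      |Real.log (place pr j g.1)| + Real.posLog (place pr j g.2)) (affPow μ n) := fun j _ =>
    integrable_affPow_gauge (place pr j) (ae_ne_zero_of_ae_mem_AffSet hμ)
      (integrable_log_place hinj hμ hmom j) (integrable_posLog_place hmom j) n
  have hsum := (integrable_finsetSum _ hj).const_mul 2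
  have hbound := (integrable_const (μ := affPow μ n) (2 * Real.log 2)).add hsum
  have hle : ∀ᵐ g ∂(affPow μ n), ratHeight g.1 + ratHeight g.2 ≤ 2 * Real.log 2 +
      2 * ∑ j, (|Real.log (place pr j g.1)| + Real.posLog (place pr j g.2)) :=
    (ae_mem_affPow (S := AffSet pr) ⟨one_mem_MP, zero_mem_ZP⟩ affMul_mem_AffSet hμ n).mono
      fun g hg =>
      ratHeight_add_ratHeight_le hinj hg
  have hintegr : Integrable (fun g : ℚ × ℚ => ratHeight g.1 + ratHeight g.2) (affPow μ n) := by
    refine hbound.mono' Measurable.of_discrete.aestronglyMeasurable ?_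
    filter_upwards [hle] with g hg
    rw [Real.norm_eq_abs, abs_of_nonneg (add_nonneg (ratHeight_nonneg _) (ratHeight_nonneg _))]
    exact hg
  refine ⟨hintegr, (integral_mono_ae hintegr hbound hle).trans (le_of_eq ?_)⟩
  rw [integral_add' (integrable_const _) hsum, integral_const, integral_const_mul,
    integral_finsetSum _ hj]
  simp

/-- The entropy of the centered random walk grows sublinearly. -/
lemma exists_shannonEntropy_affPow_le (hinj : Function.Injective pr)
    (hμ : ∀ᵐ g ∂μ, g ∈ AffSet pr) (hmom : FirstMoment pr μ)
    (hdriftInf : driftInf μ = 0) (hdrift : ∀ i, drift pr μ i = 0) {ε : ℝ} (hε : 0 < ε) :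
    ∃ n : ℕ, 0 < n ∧ shannonEntropy (affPow μ n) ≤ ε * n := by
  obtain ⟨C, hC⟩ := exists_shannonEntropy_le
  set N : ℝ := (Fintype.card (Option ι) : ℝ) with hN
  have hN0 : 0 < N := by
    rw [hN]
    exact_mod_cast Fintype.card_pos
  have hδ : 0 < ε / (8 * N) := by positivity
  have hev : ∀ᶠ m : ℕ in atTop, ∀ᶠ l : ℕ in atTop, ∀ j : Option ι,
      ∫ g, (|Real.log (place pr j g.1)| + Real.posLog (place pr j g.2)) ∂(affPow μ (m * l)) ≤
        ε / (8 * N) * (m * l : ℕ) := by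
    simp_rw [eventually_all]
    exact fun j => eventually_integral_affPow_gauge_le (place pr j)
      (ae_ne_zero_of_ae_mem_AffSet hμ) (integrable_log_place hinj hμ hmom j)
      (integrable_posLog_place hmom j) (integral_log_place_eq_zero hdriftInf hdrift j) hδ
  obtain ⟨m, hm, hm0⟩ := (hev.and (eventually_gt_atTop 0)).exists
  have hlarge : ∀ᶠ l : ℕ in atTop, C + 4 * Real.log 2 ≤ ε / 2 * (m * l : ℕ) :=
    ((tendsto_natCast_atTop_atTop.comp (tendsto_id.const_mul_atTop' hm0)).const_mul_atTop
      (half_pos hε)).eventually_ge_atTop _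
  obtain ⟨l, ⟨hl, hl'⟩, hl0⟩ := ((hm.and hlarge).and (eventually_gt_atTop 0)).exists
  refine ⟨m * l, Nat.mul_pos hm0 hl0, ?_⟩
  have h1 := integrable_affPow_ratHeight hinj hμ hmom (m * l)
  have h2 := (hC (affPow μ (m * l)) h1.1).2
  have h3 := Finset.sum_le_card_nsmul Finset.univ _ _ fun j _ => hl j
  rw [Finset.card_univ, nsmul_eq_mul, ← hN] at h3
  have h4 : N * (ε / (8 * N) * (m * l : ℕ)) = ε / 8 * (m * l : ℕ) := by field_simp
  linarith [h1.2]

end Liouville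

/-- **Liouville property in the centered case.** Let `μ` be a
probability measure on `Aff(P)` with finite first moment whose support generates
`Aff(P)` as a semigroup, and suppose `φ_p = 0` for every `p ∈ P̄`.  Then every
bounded `μ`-harmonic function on `Aff(P)` is constant. -/
theorem liouville_of_centered_drifts
    (ι : Type) [Fintype ι] [Nonempty ι] (pr : ι → ℕ) [∀ i, Fact (pr i).Prime]
    (hinj : Function.Injective pr)
    (μ : Measure (ℚ × ℚ)) [IsProbabilityMeasure μ] (hAff : μ (AffSet pr) = 1)
    (hmom : FirstMoment pr μ)
    (hgen : ∀ T : Set (ℚ × ℚ), {g : ℚ × ℚ | μ {g} ≠ 0} ⊆ T →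
      (∀ g ∈ T, ∀ h ∈ T, affMul g h ∈ T) → AffSet pr ⊆ T)
    (hdriftInf : driftInf μ = 0) (hdrift : ∀ i, drift pr μ i = 0) :
    ∀ f : ℚ × ℚ → ℝ, (∃ C : ℝ, ∀ g ∈ AffSet pr, |f g| ≤ C) →
      (∀ g ∈ AffSet pr, f g = ∫ h, f (affMul g h) ∂μ) →
      ∀ g ∈ AffSet pr, ∀ g' ∈ AffSet pr, f g = f g' := by
  have hμ : ∀ᵐ g ∂μ, g ∈ AffSet pr :=
    (prob_compl_eq_zero_iff (MeasurableSet.of_discrete (s := AffSet pr))).2 hAff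
  obtain ⟨C, hC⟩ := exists_shannonEntropy_le
  rintro f ⟨B, hB⟩ hharm
  exact eq_of_bounded_harmonic_of_entropy (S := AffSet pr) ⟨one_mem_MP, zero_mem_ZP⟩
    affMul_mem_AffSet (fun g hg => ne_zero_of_mem_MP_s17 hg.1) hμ hgen
    (fun n => (hC _ (integrable_affPow_ratHeight hinj hμ hmom n).1).1)
    (fun ε hε => exists_shannonEntropy_affPow_le hinj hμ hmom hdriftInf hdrift hε) hB hharm
end
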